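/- Let B = A^{coH} ⊆ A be a quantum principal bundle and define the Ðurđević braiding σ: A⊗_B A→A⊗_B A, σ(a⊗_B a') := a₀ a' (a₁)⟨1⟩⊗_B (a₁)⟨2⟩. Then: (i) σ is a bijective B-bimodule map with inverse σ⁻¹(a⊗_B a') = τ(S⁻¹(a'₁)) a a'₀ = S⁻¹(a'₁)⟨1⟩⊗_B S⁻¹(a'₁)⟨2⟩ a a'₀; (ii) σ satisfies the braid equation (σ⊗_B id)(id⊗_B σ)(σ⊗_B id) = (id⊗_B σ)(σ⊗_B id)(id⊗_B σ) on A⊗_B A⊗_B A; (iii) A is braided-commutative: m_A∘σ = m_A where m_A: A⊗_B A→A is the multiplication; (iv) the hexagon relations hold: σ∘(m_A⊗_B id) = (id⊗_B m_A)∘(σ⊗_B id)∘(id⊗_B σ) and σ∘(id⊗_B m_A) = (m_A⊗_B id)∘(id⊗_B σ)∘(σ⊗_B id). -/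

import Mathlib

open TensorProduct

noncomputable section

namespace NCG

variable {k : Type*} [CommRing k]

/-! ## Coactions -/

section Coactions

variable {H : Type*} [AddCommMonoid H] [Module k H] [Coalgebra k H]
variable {M : Type*} [AddCommMonoid M] [Module k M]

/-- `ρ : M → M ⊗ H` is a (counital, coassociative) right `H`-coaction. -/
def IsRightCoaction (ρ : M →ₗ[k] M ⊗[k] H) : Prop :=
  (LinearMap.lTensor M (Coalgebra.counit (R := k) (A := H)) ∘ₗ ρ
      = (TensorProduct.mk k M k).flip 1) ∧
  ((TensorProduct.assoc k M H H).toLinearMap ∘ₗ LinearMap.rTensor H ρ ∘ₗ ρ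
      = LinearMap.lTensor M (Coalgebra.comul (R := k) (A := H)) ∘ₗ ρ)

/-- `lam : M → H ⊗ M` is a left `H`-coaction. -/
def IsLeftCoaction (lam : M →ₗ[k] H ⊗[k] M) : Prop :=
  (LinearMap.rTensor M (Coalgebra.counit (R := k) (A := H)) ∘ₗ lam
      = TensorProduct.mk k k M 1) ∧
  ((TensorProduct.assoc k H H M).symm.toLinearMap ∘ₗ LinearMap.lTensor H lam ∘ₗ lam
      = LinearMap.rTensor M (Coalgebra.comul (R := k) (A := H)) ∘ₗ lam)

end Coactions

/-! ## Comodule algebras, coinvariants, Hopf–Galois extensions -/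

section ComodAlg

variable (k) in
/-- A right `H`-comodule algebra structure on `A`: an algebra morphism
`ρ : A → A ⊗ H` which is a right `H`-coaction. -/
structure ComodAlg (H : Type*) [Ring H] [Bialgebra k H]
    (A : Type*) [Ring A] [Algebra k A] where
  ρ : A →ₐ[k] A ⊗[k] H
  coaction : IsRightCoaction (k := k) ρ.toLinearMap

variable {H : Type*} [Ring H] [Bialgebra k H]
variable {A : Type*} [Ring A] [Algebra k A]

/-- The coinvariant subalgebra `B = A^{co H}` (as a submodule). -/
def ComodAlg.coinv (S : ComodAlg k H A) : Submodule k A where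
  carrier := {a | S.ρ a = a ⊗ₜ[k] (1 : H)}
  add_mem' := by
    intro a b ha hb
    simp only [Set.mem_setOf_eq] at *
    rw [map_add, ha, hb, TensorProduct.add_tmul]
  zero_mem' := by simp
  smul_mem' := by
    intro c a ha
    simp only [Set.mem_setOf_eq] at *
    rw [map_smul, ha, TensorProduct.smul_tmul']

lemma ComodAlg.one_mem_coinv (S : ComodAlg k H A) : (1 : A) ∈ S.coinv := by
  show S.ρ 1 = _
  rw [map_one, Algebra.TensorProduct.one_def]

/-- The lift `χ' : A ⊗ A → A ⊗ H`, `a ⊗ a' ↦ (a ⊗ 1) · ρ(a') = a a'₍₀₎ ⊗ a'₍₁₎`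
of the canonical Hopf–Galois map. -/
def chiAux (S : ComodAlg k H A) : A ⊗[k] A →ₗ[k] A ⊗[k] H :=
  TensorProduct.lift
    ((LinearMap.mul k (A ⊗[k] H) ∘ₗ (TensorProduct.mk k A H).flip 1).compl₂ S.ρ.toLinearMap)

/-- The relations defining the balanced tensor product `A ⊗_B A` over a
subalgebra (submodule) `B ⊆ A`. -/
def balRel (B : Submodule k A) : Submodule k (A ⊗[k] A) :=
  Submodule.span k
    {x | ∃ (a a' : A) (b : B), x = (a * (b : A)) ⊗ₜ[k] a' - a ⊗ₜ[k] ((b : A) * a')}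

/-- The balanced tensor product `A ⊗_B A`. -/
abbrev TensorOver (B : Submodule k A) : Type _ := (A ⊗[k] A) ⧸ balRel B

/-- `B = A^{co H} ⊆ A` is a Hopf–Galois extension:  the canonical map
`χ : A ⊗_B A → A ⊗ H` is bijective, i.e. its lift `χ'` is surjective with
kernel exactly the balanced relations. -/
def ComodAlg.IsHopfGalois (S : ComodAlg k H A) : Prop :=
  Function.Surjective (chiAux S) ∧ LinearMap.ker (chiAux S) = balRel S.coinv

/-- The canonical Hopf–Galois map `χ : A ⊗_B A → A ⊗ H` on the balanced
tensor product. -/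
def chiQ (S : ComodAlg k H A) (h : balRel S.coinv ≤ LinearMap.ker (chiAux S)) :
    TensorOver S.coinv →ₗ[k] A ⊗[k] H :=
  Submodule.liftQ _ (chiAux S) h

end ComodAlg

section HopfGalois

variable {H : Type*} [Ring H] [HopfAlgebra k H]
variable {A : Type*} [Ring A] [Algebra k A]

/-- A strong connection (in the sense of Theorem 3.7): a linear map
`ℓ : H → A ⊗ A` satisfying the four identities characterising faithfully
flat Hopf–Galois extensions (principal comodule algebras). -/
def IsStrongConnection (S : ComodAlg k H A) (ℓ : H →ₗ[k] A ⊗[k] A) : Prop :=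
  ℓ 1 = 1 ⊗ₜ[k] 1 ∧
  chiAux S ∘ₗ ℓ = TensorProduct.mk k A H 1 ∧
  LinearMap.mul' k A ∘ₗ ℓ =
    Algebra.linearMap k A ∘ₗ Coalgebra.counit (R := k) (A := H) ∧
  LinearMap.lTensor A S.ρ.toLinearMap ∘ₗ ℓ =
    (TensorProduct.assoc k A A H).toLinearMap ∘ₗ LinearMap.rTensor H ℓ ∘ₗ
      Coalgebra.comul (R := k) (A := H) ∧
  LinearMap.rTensor A S.ρ.toLinearMap ∘ₗ ℓ =
    LinearMap.rTensor A (TensorProduct.comm k H A).toLinearMap ∘ₗ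
      (TensorProduct.assoc k H A A).symm.toLinearMap ∘ₗ
      TensorProduct.map (HopfAlgebra.antipode (R := k)) ℓ ∘ₗ
      Coalgebra.comul (R := k) (A := H)

/-- A quantum principal bundle: a faithfully flat Hopf–Galois extension
`B = A^{co H} ⊆ A`, encoded (following Theorem 3.7 = Th. 6.19/6.20 of
Brzeziński–Wisbauer/Hajac et al.) as a Hopf–Galois extension admitting a
strong connection. -/
def ComodAlg.IsQPB (S : ComodAlg k H A) : Prop :=
  S.IsHopfGalois ∧ ∃ ℓ : H →ₗ[k] A ⊗[k] A, IsStrongConnection S ℓ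

end HopfGalois

/-! ## Differential graded algebras and differential calculi -/

section DGA

variable (k) in
/-- A differential graded algebra: an `ℕ`-graded algebra `Ω` together with a
degree `1` differential squaring to zero and satisfying the graded Leibniz
rule. -/
structure DGA (Ω : Type*) [Ring Ω] [Algebra k Ω] where
  grading : ℕ → Submodule k Ω
  gradedAlgebra : GradedAlgebra grading
  d : Ω →ₗ[k] Ω
  d_mem : ∀ n, ∀ x ∈ grading n, d x ∈ grading (n + 1)
  d_d : ∀ x, d (d x) = 0
  leibniz : ∀ n, ∀ ω ∈ grading n, ∀ η,
    d (ω * η) = d ω * η + ((-1 : k) ^ n) • (ω * d η)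

variable {Ω : Type*} [Ring Ω] [Algebra k Ω]

/-- Projection onto the degree `n` component of a graded algebra. -/
def DGA.projN (C : DGA k Ω) (n : ℕ) : Ω →ₗ[k] Ω :=
  letI := C.gradedAlgebra
  (C.grading n).subtype ∘ₗ DirectSum.component k ℕ (fun i => ↥(C.grading i)) n ∘ₗ
    (DirectSum.decomposeLinearEquiv C.grading).toLinearMap

/-- The sign operator `ς` of a graded algebra, acting by `(-1)^n` in degree `n`. -/
def DGA.sign (C : DGA k Ω) : Ω →ₗ[k] Ω :=
  letI := C.gradedAlgebra
  (DirectSum.toModule k ℕ Ω fun n => ((-1 : k) ^ n) • (C.grading n).subtype) ∘ₗ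
    (DirectSum.decomposeLinearEquiv C.grading).toLinearMap

variable {Ξ : Type*} [Ring Ξ] [Algebra k Ξ]
variable {M : Type*} [AddCommGroup M] [Module k M]

/-- The graded (Koszul) braiding `Ξ ⊗ M → M ⊗ Ξ`, `θ ⊗ m ↦ (-1)^{|θ||m|} m ⊗ θ`,
where the sign on `M` is implemented by the sign operator `s`. -/
def gradedBraid (CN : DGA k Ξ) (s : M →ₗ[k] M) : Ξ ⊗[k] M →ₗ[k] M ⊗[k] Ξ :=
  letI := CN.gradedAlgebra
  TensorProduct.lift
    ((DirectSum.toModule k ℕ (M →ₗ[k] M ⊗[k] Ξ) fun j =>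
        (LinearMap.llcomp k M M (M ⊗[k] Ξ)).flip (s ^ j) ∘ₗ
          (TensorProduct.mk k M Ξ).flip ∘ₗ (CN.grading j).subtype) ∘ₗ
      (DirectSum.decomposeLinearEquiv CN.grading).toLinearMap)

/-- The multiplication of the graded (Koszul-signed) tensor product
`(m ⊗ θ)(m' ⊗ θ') = (-1)^{|θ||m'|} m m' ⊗ θ θ'`, for a (possibly non-unital
carrier) `M` with multiplication `mulM` and sign operator `sM`, and a graded
algebra `Ξ`. -/
def koszulMulGen (mulM : M ⊗[k] M →ₗ[k] M) (mulN : Ξ ⊗[k] Ξ →ₗ[k] Ξ)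
    (CN : DGA k Ξ) (sM : M →ₗ[k] M) :
    (M ⊗[k] Ξ) ⊗[k] (M ⊗[k] Ξ) →ₗ[k] M ⊗[k] Ξ :=
  TensorProduct.map mulM mulN ∘ₗ
    (TensorProduct.assoc k (M ⊗[k] M) Ξ Ξ).toLinearMap ∘ₗ
    LinearMap.rTensor Ξ
      ((TensorProduct.assoc k M M Ξ).symm.toLinearMap ∘ₗ
        LinearMap.lTensor M (gradedBraid CN sM) ∘ₗ
        (TensorProduct.assoc k M Ξ M).toLinearMap) ∘ₗ
    (TensorProduct.assoc k (M ⊗[k] Ξ) M Ξ).symm.toLinearMap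

/-- The Koszul multiplication on the tensor product of two graded algebras. -/
def koszulMul (CM : DGA k Ω) (CN : DGA k Ξ) :
    (Ω ⊗[k] Ξ) ⊗[k] (Ω ⊗[k] Ξ) →ₗ[k] Ω ⊗[k] Ξ :=
  koszulMulGen (LinearMap.mul' k Ω) (LinearMap.mul' k Ξ) CN CM.sign

/-- The tensor product differential `d_⊗ = d ⊗ 1 + ς ⊗ d'`. -/
def dTensorGen (dM : M →ₗ[k] M) (sM : M →ₗ[k] M) {N : Type*} [AddCommGroup N]
    [Module k N] (dN : N →ₗ[k] N) : M ⊗[k] N →ₗ[k] M ⊗[k] N :=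
  TensorProduct.map dM LinearMap.id + TensorProduct.map sM dN

/-- The grading of the tensor product of two graded modules. -/
def tensorGrading {N : Type*} [AddCommGroup N] [Module k N]
    (𝒜 : ℕ → Submodule k M) (ℬ : ℕ → Submodule k N) (n : ℕ) :
    Submodule k (M ⊗[k] N) :=
  ⨆ p : {p : ℕ × ℕ // p.1 + p.2 = n},
    LinearMap.range (TensorProduct.map (𝒜 p.1.1).subtype (ℬ p.1.2).subtype)

end DGA

section DiffCalc

variable (k) in
/-- A differential calculus on an algebra `A`: a differential graded algebra
`Ω` with degree-zero part `A` (embedded via `ι`), generated in degree zero. -/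
structure DiffCalc (A : Type*) [Ring A] [Algebra k A]
    (Ω : Type*) [Ring Ω] [Algebra k Ω] extends DGA k Ω where
  ι : A →ₐ[k] Ω
  ι_injective : Function.Injective ι
  range_ι : ∀ x, x ∈ grading 0 ↔ x ∈ Set.range ι
  generated : Algebra.adjoin k (Set.range ι ∪ ⇑d '' Set.range ι) = ⊤

variable {A : Type*} [Ring A] [Algebra k A]
variable {Ω : Type*} [Ring Ω] [Algebra k Ω]

lemma DiffCalc.ι_mem (C : DiffCalc k A Ω) (a : A) : C.ι a ∈ C.grading 0 :=
  (C.range_ι _).2 ⟨a, rfl⟩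

lemma DiffCalc.d_ι_mem (C : DiffCalc k A Ω) (a : A) : C.d (C.ι a) ∈ C.grading 1 := by
  simpa using C.d_mem 0 (C.ι a) (C.ι_mem a)

lemma DiffCalc.sandwich_mem (C : DiffCalc k A Ω) (a b : A) {x : Ω}
    (hx : x ∈ C.grading 1) : C.ι a * x * C.ι b ∈ C.grading 1 := by
  letI := C.gradedAlgebra
  have h1 : C.ι a * x ∈ C.grading (0 + 1) := SetLike.mul_mem_graded (C.ι_mem a) hx
  have h2 : C.ι a * x * C.ι b ∈ C.grading (0 + 1 + 0) :=
    SetLike.mul_mem_graded h1 (C.ι_mem b)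
  simpa using h2

/-- The degree-zero identification `A ≃ Ω⁰`. -/
def DiffCalc.iota0 (C : DiffCalc k A Ω) : A ≃ₗ[k] ↥(C.grading 0) :=
  LinearEquiv.ofBijective (LinearMap.codRestrict (C.grading 0) C.ι.toLinearMap C.ι_mem)
    ⟨fun a b hab => C.ι_injective (congrArg Subtype.val hab),
     fun y => by
      obtain ⟨a, ha⟩ := (C.range_ι ↑y).1 y.2
      exact ⟨a, Subtype.ext ha⟩⟩

/-- Projection `Ω → A` onto the degree-zero component. -/
def DiffCalc.proj0 (C : DiffCalc k A Ω) : Ω →ₗ[k] A :=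
  letI := C.gradedAlgebra
  C.iota0.symm.toLinearMap ∘ₗ DirectSum.component k ℕ (fun i => ↥(C.grading i)) 0 ∘ₗ
    (DirectSum.decomposeLinearEquiv C.grading).toLinearMap

end DiffCalc

/-! ## Covariant calculi -/

section Covariant

variable {H : Type*} [Ring H] [Bialgebra k H]
variable {A : Type*} [Ring A] [Algebra k A]
variable {Ω : Type*} [Ring Ω] [Algebra k Ω]

/-- The comultiplication of a bialgebra, as a comodule-algebra structure of
`H` over itself. -/
def comulComod (k : Type*) [CommRing k] (H : Type*) [Ring H] [Bialgebra k H] :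
    ComodAlg k H H where
  ρ := Bialgebra.comulAlgHom k H
  coaction := by
    constructor
    · exact Coalgebra.lTensor_counit_comp_comul
    · exact Coalgebra.coassoc

/-- A right `H`-covariant differential calculus on a comodule algebra `A`:
the coaction `ΔR` extends `ρ` multiplicatively, degree-wise, and commutes
with the differential. -/
def IsRightCovariant (S : ComodAlg k H A) (C : DiffCalc k A Ω)
    (ΔR : Ω →ₗ[k] Ω ⊗[k] H) : Prop :=
  IsRightCoaction (k := k) ΔR ∧
  ΔR 1 = 1 ∧ (∀ x y, ΔR (x * y) = ΔR x * ΔR y) ∧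
  (∀ n, ∀ x ∈ C.grading n,
    ΔR x ∈ LinearMap.range (LinearMap.rTensor H (C.grading n).subtype)) ∧
  ΔR ∘ₗ C.d = LinearMap.rTensor H C.d ∘ₗ ΔR ∧
  ΔR ∘ₗ C.ι.toLinearMap = LinearMap.rTensor H C.ι.toLinearMap ∘ₗ S.ρ.toLinearMap

/-- A left-covariant differential calculus on the Hopf algebra `H` itself:
the left coaction `ΛL` extends the comultiplication. -/
def IsLeftCovariantH (C : DiffCalc k H Ω) (ΛL : Ω →ₗ[k] H ⊗[k] Ω) : Prop :=
  IsLeftCoaction (k := k) ΛL ∧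
  ΛL 1 = 1 ∧ (∀ x y, ΛL (x * y) = ΛL x * ΛL y) ∧
  (∀ n, ∀ x ∈ C.grading n,
    ΛL x ∈ LinearMap.range (LinearMap.lTensor H (C.grading n).subtype)) ∧
  ΛL ∘ₗ C.d = LinearMap.lTensor H C.d ∘ₗ ΛL ∧
  ΛL ∘ₗ C.ι.toLinearMap =
    LinearMap.lTensor H C.ι.toLinearMap ∘ₗ Coalgebra.comul (R := k) (A := H)

/-- A bicovariant differential calculus on `H`: commuting right and left
covariant structures both extending the comultiplication. -/
def IsBicovariantH (C : DiffCalc k H Ω) (ΔR : Ω →ₗ[k] Ω ⊗[k] H)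
    (ΛL : Ω →ₗ[k] H ⊗[k] Ω) : Prop :=
  IsRightCovariant (comulComod k H) C ΔR ∧ IsLeftCovariantH C ΛL ∧
  LinearMap.rTensor H ΛL ∘ₗ ΔR =
    (TensorProduct.assoc k H Ω H).symm.toLinearMap ∘ₗ LinearMap.lTensor H ΔR ∘ₗ ΛL

/-- Left-coinvariant elements of a left comodule. -/
def leftCoinv {M : Type*} [AddCommGroup M] [Module k M]
    (lam : M →ₗ[k] H ⊗[k] M) : Submodule k M where
  carrier := {m | lam m = 1 ⊗ₜ[k] m}
  add_mem' := by
    intro a b ha hb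
    simp only [Set.mem_setOf_eq] at *
    rw [map_add, ha, hb, TensorProduct.tmul_add]
  zero_mem' := by simp
  smul_mem' := by
    intro c m hm
    simp only [Set.mem_setOf_eq] at *
    rw [map_smul, hm, TensorProduct.tmul_smul]

end Covariant

/-! ## Maximal prolongations -/

section MaxProl

universe u

variable {A : Type*} [Ring A] [Algebra k A]
variable {Ω : Type*} [Ring Ω] [Algebra k Ω]

/-- `g` identifies the first-order parts of the differential calculi `C` and
`C'` (as first order differential calculi over `A`). -/
def Matches1 {Ω' : Type*} [Ring Ω'] [Algebra k Ω'] (C : DiffCalc k A Ω)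
    (C' : DiffCalc k A Ω') (g : ↥(C.grading 1) →ₗ[k] Ω') : Prop :=
  (∀ x : C.grading 1, g x ∈ C'.grading 1) ∧
  Function.Injective g ∧
  (∀ y ∈ C'.grading 1, ∃ x, g x = y) ∧
  (∀ a : A, g ⟨C.d (C.ι a), C.d_ι_mem a⟩ = C'.d (C'.ι a)) ∧
  (∀ (a b : A) (x : C.grading 1),
    g ⟨C.ι a * ↑x * C.ι b, C.sandwich_mem a b x.2⟩ = C'.ι a * g x * C'.ι b)

/-- `C` is the maximal prolongation of its own first-order part: any other
differential calculus on `A` with the same first order is a quotient of `C`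
(universal property of the maximal prolongation). -/
def IsMaxProl (C : DiffCalc k A Ω) : Prop :=
  ∀ (Ω' : Type u) [Ring Ω'] [Algebra k Ω'], ∀ (C' : DiffCalc k A Ω')
    (g : ↥(C.grading 1) →ₗ[k] Ω'), Matches1 C C' g →
    ∃ Φ : Ω →ₐ[k] Ω',
      (∀ n, ∀ x ∈ C.grading n, Φ x ∈ C'.grading n) ∧
      (∀ x, Φ (C.d x) = C'.d (Φ x)) ∧
      (∀ a, Φ (C.ι a) = C'.ι a) ∧
      (∀ x : C.grading 1, Φ ↑x = g x)

end MaxProl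

/-! ## Complete calculi -/

section Complete

variable {H : Type*} [Ring H] [HopfAlgebra k H]
variable {A : Type*} [Ring A] [Algebra k A]
variable {ΩA : Type*} [Ring ΩA] [Algebra k ΩA]
variable {ΩH : Type*} [Ring ΩH] [Algebra k ΩH]

/-- `D` is an extension of the coaction `ρ : A → A ⊗ H` to a morphism of
differential graded algebras `Ω(A) → Ω(A) ⊗ Ω(H)` (Koszul signs built into
the target); i.e. the calculus `Ω(A)` is *complete* with extension `D`. -/
def IsCompleteExt (S : ComodAlg k H A) (CA : DiffCalc k A ΩA)
    (CH : DiffCalc k H ΩH) (D : ΩA →ₗ[k] ΩA ⊗[k] ΩH) : Prop :=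
  D 1 = 1 ⊗ₜ[k] 1 ∧
  (∀ x y, D (x * y) = koszulMul CA.toDGA CH.toDGA (D x ⊗ₜ[k] D y)) ∧
  D ∘ₗ CA.ι.toLinearMap =
    TensorProduct.map CA.ι.toLinearMap CH.ι.toLinearMap ∘ₗ S.ρ.toLinearMap ∧
  D ∘ₗ CA.d = dTensorGen CA.d CA.toDGA.sign CH.d ∘ₗ D ∧
  (∀ n, ∀ x ∈ CA.grading n, D x ∈ tensorGrading CA.grading CH.grading n)

/-- A complete calculus on the Hopf algebra `H` itself: the comultiplication
extends to a morphism of differential graded algebras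
`Ω(H) → Ω(H) ⊗ Ω(H)`. -/
def IsCompleteExtH (CH : DiffCalc k H ΩH) (D : ΩH →ₗ[k] ΩH ⊗[k] ΩH) : Prop :=
  IsCompleteExt (comulComod k H) CH CH D

/-- The graded counit `ε•` of a complete calculus on `H`: the counit in degree
zero and zero in positive degrees. -/
def epsBul (CH : DiffCalc k H ΩH) : ΩH →ₗ[k] k :=
  Coalgebra.counit (R := k) (A := H) ∘ₗ CH.proj0

end Complete

end NCG
namespace NCG

variable {k : Type*} [CommRing k]

/-! ## First order differential calculi -/

section FODC

variable (k) in
/-- A first order differential calculus `(Γ, d)` on `A`: an `A`-bimodule `Γ`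
(with explicit structure maps) together with a derivation `d : A → Γ`
generating `Γ`. -/
structure FODC (A : Type*) [Ring A] [Algebra k A]
    (Γ : Type*) [AddCommGroup Γ] [Module k Γ] where
  lsmul : A →ₗ[k] Γ →ₗ[k] Γ
  rsmul : A →ₗ[k] Γ →ₗ[k] Γ
  one_lsmul : ∀ x, lsmul 1 x = x
  one_rsmul : ∀ x, rsmul 1 x = x
  mul_lsmul : ∀ a b x, lsmul (a * b) x = lsmul a (lsmul b x)
  mul_rsmul : ∀ a b x, rsmul (a * b) x = rsmul b (rsmul a x)
  lsmul_rsmul : ∀ a b x, lsmul a (rsmul b x) = rsmul b (lsmul a x)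
  d : A →ₗ[k] Γ
  leibniz : ∀ a b, d (a * b) = lsmul a (d b) + rsmul b (d a)
  surj : Submodule.span k {x | ∃ a b, x = lsmul a (d b)} = ⊤

end FODC

/-! ## Diagonal actions on tensor products -/

section ActionHelpers

variable {A H Γ : Type*} [Ring A] [Algebra k A] [Ring H] [Algebra k H]
variable [AddCommGroup Γ] [Module k Γ]

/-- Left action of `A ⊗ H` on `Γ ⊗ H`: `(a ⊗ h) ⊳ (x ⊗ g) = (a ⊳ x) ⊗ h g`. -/
def lactTH (act : A →ₗ[k] Γ →ₗ[k] Γ) :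
    (A ⊗[k] H) →ₗ[k] (Γ ⊗[k] H) →ₗ[k] Γ ⊗[k] H :=
  TensorProduct.curry
    (TensorProduct.map (TensorProduct.lift act) (LinearMap.mul' k H) ∘ₗ
      (TensorProduct.tensorTensorTensorComm k A H Γ H).toLinearMap)

/-- Right action of `A ⊗ H` on `Γ ⊗ H`: `(x ⊗ g) ⊲ (a ⊗ h) = (x ⊲ a) ⊗ g h`. -/
def ractTH (act : A →ₗ[k] Γ →ₗ[k] Γ) :
    (A ⊗[k] H) →ₗ[k] (Γ ⊗[k] H) →ₗ[k] Γ ⊗[k] H :=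
  TensorProduct.curry
    (TensorProduct.map (TensorProduct.lift act)
        (LinearMap.mul' k H ∘ₗ (TensorProduct.comm k H H).toLinearMap) ∘ₗ
      (TensorProduct.tensorTensorTensorComm k A H Γ H).toLinearMap)

/-- Left action of `A ⊗ H` on `A ⊗ Γ`: `(a ⊗ h) ⊳ (c ⊗ x) = a c ⊗ (h ⊳ x)`. -/
def lactHT (act : H →ₗ[k] Γ →ₗ[k] Γ) :
    (A ⊗[k] H) →ₗ[k] (A ⊗[k] Γ) →ₗ[k] A ⊗[k] Γ :=
  TensorProduct.curry
    (TensorProduct.map (LinearMap.mul' k A) (TensorProduct.lift act) ∘ₗ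
      (TensorProduct.tensorTensorTensorComm k A H A Γ).toLinearMap)

/-- Right action of `A ⊗ H` on `A ⊗ Γ`: `(c ⊗ x) ⊲ (a ⊗ h) = c a ⊗ (x ⊲ h)`. -/
def ractHT (act : H →ₗ[k] Γ →ₗ[k] Γ) :
    (A ⊗[k] H) →ₗ[k] (A ⊗[k] Γ) →ₗ[k] A ⊗[k] Γ :=
  TensorProduct.curry
    (TensorProduct.map (LinearMap.mul' k A ∘ₗ (TensorProduct.comm k A A).toLinearMap)
        (TensorProduct.lift act) ∘ₗ
      (TensorProduct.tensorTensorTensorComm k A H A Γ).toLinearMap)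

end ActionHelpers

/-! ## Covariant first order calculi and first order extensions -/

section FODCCov

variable {H : Type*} [Ring H] [Bialgebra k H]
variable {A : Type*} [Ring A] [Algebra k A]
variable {Γ : Type*} [AddCommGroup Γ] [Module k Γ]
variable {ΓH : Type*} [AddCommGroup ΓH] [Module k ΓH]

/-- Right `H`-covariance of a FODC `(Γ, d)` on a comodule algebra `A`. -/
def FODC.IsRightCovariant (S : ComodAlg k H A) (C : FODC k A Γ)
    (ΔΓ : Γ →ₗ[k] Γ ⊗[k] H) : Prop :=
  IsRightCoaction (k := k) ΔΓ ∧
  (∀ a x, ΔΓ (C.lsmul a x) = lactTH C.lsmul (S.ρ a) (ΔΓ x)) ∧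
  (∀ a x, ΔΓ (C.rsmul a x) = ractTH C.rsmul (S.ρ a) (ΔΓ x)) ∧
  ΔΓ ∘ₗ C.d = LinearMap.rTensor H C.d ∘ₗ S.ρ.toLinearMap

/-- Left covariance of a FODC `(Γ, d)` on the Hopf algebra `H` itself. -/
def FODC.IsLeftCovariantH (C : FODC k H Γ) (ΛΓ : Γ →ₗ[k] H ⊗[k] Γ) : Prop :=
  IsLeftCoaction (k := k) ΛΓ ∧
  (∀ h x, ΛΓ (C.lsmul h x) =
    lactHT C.lsmul (Coalgebra.comul (R := k) (A := H) h) (ΛΓ x)) ∧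
  (∀ h x, ΛΓ (C.rsmul h x) =
    ractHT C.rsmul (Coalgebra.comul (R := k) (A := H) h) (ΛΓ x)) ∧
  ΛΓ ∘ₗ C.d = LinearMap.lTensor H C.d ∘ₗ Coalgebra.comul (R := k) (A := H)

/-- Bicovariance of a FODC on `H`: commuting right and left covariant
structures. -/
def FODC.IsBicovariantH (C : FODC k H Γ) (ΔΓ : Γ →ₗ[k] Γ ⊗[k] H)
    (ΛΓ : Γ →ₗ[k] H ⊗[k] Γ) : Prop :=
  FODC.IsRightCovariant (comulComod k H) C ΔΓ ∧ FODC.IsLeftCovariantH C ΛΓ ∧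
  LinearMap.rTensor H ΛΓ ∘ₗ ΔΓ =
    (TensorProduct.assoc k H Γ H).symm.toLinearMap ∘ₗ LinearMap.lTensor H ΔΓ ∘ₗ ΛΓ

/-- `D` is an extension of the coaction `ρ : A → A ⊗ H` to a morphism of first
order differential calculi `Γ_A → Ω¹(A ⊗ H) = (Γ_A ⊗ H) ⊕ (A ⊗ Γ_H)`, i.e.
a map covering `ρ`, `ρ`-bilinear and intertwining `d` with `d_⊗`. -/
def IsFirstOrderExt (S : ComodAlg k H A) (CA : FODC k A Γ) (CHf : FODC k H ΓH)
    (D : Γ →ₗ[k] (Γ ⊗[k] H) × (A ⊗[k] ΓH)) : Prop :=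
  (∀ a x, D (CA.lsmul a x) =
    (lactTH CA.lsmul (S.ρ a) (D x).1, lactHT CHf.lsmul (S.ρ a) (D x).2)) ∧
  (∀ a x, D (CA.rsmul a x) =
    (ractTH CA.rsmul (S.ρ a) (D x).1, ractHT CHf.rsmul (S.ρ a) (D x).2)) ∧
  D ∘ₗ CA.d =
    (LinearMap.rTensor H CA.d ∘ₗ S.ρ.toLinearMap).prod
      (LinearMap.lTensor A CHf.d ∘ₗ S.ρ.toLinearMap)

end FODCCov

/-! ## Vertical forms -/

section Vertical

variable {H : Type*} [Ring H] [HopfAlgebra k H]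
variable {A : Type*} [Ring A] [Algebra k A]
variable {ΩH : Type*} [Ring ΩH] [Algebra k ΩH]

/-- Two-sided multiplication `Ω ⊗ Ω →ₗ (Ω →ₗ Ω)`, `(x ⊗ z) ↦ (y ↦ x y z)`. -/
def bimul (Ω : Type*) [Ring Ω] [Algebra k Ω] : Ω ⊗[k] Ω →ₗ[k] Ω →ₗ[k] Ω :=
  TensorProduct.lift
    ((LinearMap.llcomp k Ω Ω Ω ∘ₗ LinearMap.mul k Ω).compl₂ (LinearMap.mul k Ω).flip)

/-- The right adjoint action `ω ↼ h = S(h₁) ω h₂` of `H` on forms `Ω(H)`. -/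
def adAct (CH : DiffCalc k H ΩH) : H →ₗ[k] ΩH →ₗ[k] ΩH :=
  bimul ΩH ∘ₗ
    TensorProduct.map (CH.ι.toLinearMap ∘ₗ HopfAlgebra.antipode (R := k))
      CH.ι.toLinearMap ∘ₗ
    Coalgebra.comul (R := k) (A := H)

/-- The Cartan–Maurer map `h ↦ ϖ(π_ε(h)) = S(h₁) d(h₂)`. -/
def cartan (CH : DiffCalc k H ΩH) : H →ₗ[k] ΩH :=
  LinearMap.mul' k ΩH ∘ₗ
    TensorProduct.map (CH.ι.toLinearMap ∘ₗ HopfAlgebra.antipode (R := k))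
      (CH.d ∘ₗ CH.ι.toLinearMap) ∘ₗ
    Coalgebra.comul (R := k) (A := H)

/-- The projection `π_Λ : ω ↦ S(ω₋₁) ω₀` onto left-coinvariant forms. -/
def piLam (CH : DiffCalc k H ΩH) (ΛL : ΩH →ₗ[k] H ⊗[k] ΩH) : ΩH →ₗ[k] ΩH :=
  LinearMap.mul' k ΩH ∘ₗ
    TensorProduct.map (CH.ι.toLinearMap ∘ₗ HopfAlgebra.antipode (R := k))
      LinearMap.id ∘ₗ ΛL

/-- The multiplication `(a ⊗ ϑ) ∧ (a' ⊗ ϑ') = a a'₍₀₎ ⊗ (ϑ ↼ a'₍₁₎) ∧ ϑ'` of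
vertical forms, as a map on the ambient space `A ⊗ Ω(H)`. -/
def verMul (S : ComodAlg k H A) (CH : DiffCalc k H ΩH) :
    (A ⊗[k] ΩH) ⊗[k] (A ⊗[k] ΩH) →ₗ[k] A ⊗[k] ΩH :=
  TensorProduct.map (LinearMap.mul' k A)
      (LinearMap.mul' k ΩH ∘ₗ
        LinearMap.rTensor ΩH (TensorProduct.lift (adAct CH).flip) ∘ₗ
        (TensorProduct.assoc k ΩH H ΩH).symm.toLinearMap) ∘ₗ
    (TensorProduct.tensorTensorTensorComm k A ΩH A (H ⊗[k] ΩH)).toLinearMap ∘ₗ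
    LinearMap.lTensor (A ⊗[k] ΩH)
      ((TensorProduct.assoc k A H ΩH).toLinearMap ∘ₗ
        LinearMap.rTensor ΩH S.ρ.toLinearMap)

/-- The vertical differential
`d_v(a ⊗ ϑ) = a ⊗ dϑ + a₍₀₎ ⊗ ϖ(π_ε(a₍₁₎)) ∧ ϑ`. -/
def verD (S : ComodAlg k H A) (CH : DiffCalc k H ΩH) :
    A ⊗[k] ΩH →ₗ[k] A ⊗[k] ΩH :=
  LinearMap.lTensor A CH.d +
    LinearMap.lTensor A
        (LinearMap.mul' k ΩH ∘ₗ LinearMap.rTensor ΩH (cartan CH)) ∘ₗ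
      (TensorProduct.assoc k A H ΩH).toLinearMap ∘ₗ
      LinearMap.rTensor ΩH S.ρ.toLinearMap

/-- The vertical forms `ver• = A ⊗ Λ•` as a submodule of `A ⊗ Ω(H)`. -/
def verSub (A : Type*) [Ring A] [Algebra k A] (ΛL : ΩH →ₗ[k] H ⊗[k] ΩH) :
    Submodule k (A ⊗[k] ΩH) :=
  LinearMap.range (LinearMap.lTensor A (leftCoinv ΛL).subtype)

/-- The degree-`n` vertical forms `ver^n = A ⊗ Λⁿ`. -/
def verSubN (A : Type*) [Ring A] [Algebra k A] (CH : DiffCalc k H ΩH)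
    (ΛL : ΩH →ₗ[k] H ⊗[k] ΩH) (n : ℕ) : Submodule k (A ⊗[k] ΩH) :=
  LinearMap.range (LinearMap.lTensor A ((leftCoinv ΛL ⊓ CH.grading n)).subtype)

end Vertical

/-! ## Quotient multiplications on balanced tensor products -/

section QuotMul

variable {A : Type*} [Ring A] [Algebra k A]

/-- Left multiplication (by `x`) on the first leg of `A ⊗ A`, followed by the
projection onto `A ⊗_B A`. -/
def lmulQaux (B : Submodule k A) (x : A) :
    A ⊗[k] A →ₗ[k] TensorOver (k := k) B :=
  (balRel B).mkQ ∘ₗ LinearMap.rTensor A (LinearMap.mul k A x)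

lemma lmulQaux_rel (B : Submodule k A) (x : A) :
    balRel (k := k) B ≤ LinearMap.ker (lmulQaux B x) := by
  refine Submodule.span_le.mpr ?_
  rintro z ⟨a, a', b, rfl⟩
  simp only [SetLike.mem_coe, LinearMap.mem_ker, lmulQaux, LinearMap.coe_comp,
    Function.comp_apply, map_sub, LinearMap.rTensor_tmul, LinearMap.mul_apply']
  rw [← map_sub, Submodule.mkQ_apply, Submodule.Quotient.mk_eq_zero]
  apply Submodule.subset_span
  exact ⟨x * a, a', b, by rw [mul_assoc]⟩

/-- Left multiplication on the first leg of `A ⊗_B A`. -/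
def lmulQ (B : Submodule k A) :
    A →ₗ[k] TensorOver (k := k) B →ₗ[k] TensorOver (k := k) B where
  toFun x := Submodule.liftQ _ (lmulQaux B x) (lmulQaux_rel B x)
  map_add' x y := by
    apply Submodule.linearMap_qext
    simp only [Submodule.liftQ_mkQ, LinearMap.add_comp, Submodule.liftQ_mkQ]
    simp only [lmulQaux, map_add, LinearMap.rTensor_add, LinearMap.comp_add]
  map_smul' c x := by
    apply Submodule.linearMap_qext
    simp only [RingHom.id_apply, Submodule.liftQ_mkQ, LinearMap.smul_comp,
      Submodule.liftQ_mkQ]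
    simp only [lmulQaux, map_smul, LinearMap.rTensor_smul, LinearMap.comp_smul]

/-- Right multiplication (by `x`) on the second leg of `A ⊗ A`, followed by
the projection onto `A ⊗_B A`. -/
def rmulQaux (B : Submodule k A) (x : A) :
    A ⊗[k] A →ₗ[k] TensorOver (k := k) B :=
  (balRel B).mkQ ∘ₗ LinearMap.lTensor A ((LinearMap.mul k A).flip x)

lemma rmulQaux_rel (B : Submodule k A) (x : A) :
    balRel (k := k) B ≤ LinearMap.ker (rmulQaux B x) := by
  refine Submodule.span_le.mpr ?_
  rintro z ⟨a, a', b, rfl⟩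
  simp only [SetLike.mem_coe, LinearMap.mem_ker, rmulQaux, LinearMap.coe_comp,
    Function.comp_apply, map_sub, LinearMap.lTensor_tmul, LinearMap.flip_apply,
    LinearMap.mul_apply']
  rw [← map_sub, Submodule.mkQ_apply, Submodule.Quotient.mk_eq_zero]
  apply Submodule.subset_span
  exact ⟨a, a' * x, b, by rw [mul_assoc]⟩

/-- Right multiplication on the second leg of `A ⊗_B A`. -/
def rmulQ (B : Submodule k A) :
    A →ₗ[k] TensorOver (k := k) B →ₗ[k] TensorOver (k := k) B where
  toFun x := Submodule.liftQ _ (rmulQaux B x) (rmulQaux_rel B x)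
  map_add' x y := by
    apply Submodule.linearMap_qext
    simp only [Submodule.liftQ_mkQ, LinearMap.add_comp, Submodule.liftQ_mkQ]
    simp only [rmulQaux, map_add, LinearMap.lTensor_add, LinearMap.comp_add]
  map_smul' c x := by
    apply Submodule.linearMap_qext
    simp only [RingHom.id_apply, Submodule.liftQ_mkQ, LinearMap.smul_comp,
      Submodule.liftQ_mkQ]
    simp only [rmulQaux, map_smul, LinearMap.lTensor_smul, LinearMap.comp_smul]

end QuotMul

/-! ## Base, horizontal and balanced graded forms -/

section GradedHG

variable {H : Type*} [Ring H] [HopfAlgebra k H]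
variable {A : Type*} [Ring A] [Algebra k A]
variable {ΩA : Type*} [Ring ΩA] [Algebra k ΩA]
variable {ΩH : Type*} [Ring ΩH] [Algebra k ΩH]

/-- The base forms `Ω•(B)`: forms invariant under the extended coaction. -/
def baseForms (D : ΩA →ₗ[k] ΩA ⊗[k] ΩH) : Submodule k ΩA where
  carrier := {ω | D ω = ω ⊗ₜ[k] 1}
  add_mem' := by
    intro a b ha hb
    simp only [Set.mem_setOf_eq] at *
    rw [map_add, ha, hb, TensorProduct.add_tmul]
  zero_mem' := by simp
  smul_mem' := by
    intro c a ha
    simp only [Set.mem_setOf_eq] at *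
    rw [map_smul, ha, TensorProduct.smul_tmul']

/-- The horizontal forms `hor• = (Δ_A•)⁻¹(Ω•(A) ⊗ H)`. -/
def horForms (CH : DiffCalc k H ΩH) (D : ΩA →ₗ[k] ΩA ⊗[k] ΩH) : Submodule k ΩA :=
  Submodule.comap D (LinearMap.range (LinearMap.lTensor ΩA CH.ι.toLinearMap))

/-- The lift `Ω(A) ⊗ Ω(A) → Ω(A) ⊗ Ω(H)`, `ω ⊗ η ↦ (ω ∧ η₍₀₎) ⊗ η₍₁₎` of the
graded canonical Hopf–Galois map. -/
def chiBulAux (D : ΩA →ₗ[k] ΩA ⊗[k] ΩH) : ΩA ⊗[k] ΩA →ₗ[k] ΩA ⊗[k] ΩH :=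
  LinearMap.rTensor ΩH (LinearMap.mul' k ΩA) ∘ₗ
    (TensorProduct.assoc k ΩA ΩA ΩH).symm.toLinearMap ∘ₗ LinearMap.lTensor ΩA D

end GradedHG

end NCG
namespace NCG

section S16defs

variable {k : Type*} [CommRing k]
variable {H : Type*} [Ring H] [HopfAlgebra k H]
variable {A : Type*} [Ring A] [Algebra k A]

/-- The lift `a ⊗ a' ↦ a₍₀₎ a' ⋅ τ(a₍₁₎)` of the Ðurđević braiding `σ`. -/
def braidAux (S : ComodAlg k H A) (τ : H →ₗ[k] TensorOver (k := k) S.coinv) :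
    A ⊗[k] A →ₗ[k] TensorOver (k := k) S.coinv :=
  TensorProduct.lift (lmulQ S.coinv) ∘ₗ
    TensorProduct.map (LinearMap.mul' k A) τ ∘ₗ
    (TensorProduct.assoc k A A H).symm.toLinearMap ∘ₗ
    LinearMap.lTensor A (TensorProduct.comm k H A).toLinearMap ∘ₗ
    (TensorProduct.assoc k A H A).toLinearMap ∘ₗ
    LinearMap.rTensor A S.ρ.toLinearMap

/-- The lift `a ⊗ a' ↦ τ(S⁻¹(a'₍₁₎)) ⋅ a a'₍₀₎` of the inverse braiding. -/
def braidInvAux (S : ComodAlg k H A) (Sinv : H →ₗ[k] H)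
    (τ : H →ₗ[k] TensorOver (k := k) S.coinv) :
    A ⊗[k] A →ₗ[k] TensorOver (k := k) S.coinv :=
  TensorProduct.lift (rmulQ S.coinv) ∘ₗ
    TensorProduct.map (LinearMap.mul' k A) (τ ∘ₗ Sinv) ∘ₗ
    (TensorProduct.assoc k A A H).symm.toLinearMap ∘ₗ
    LinearMap.lTensor A S.ρ.toLinearMap

/-- The balanced relations on `(A ⊗ A) ⊗ A` over `B`, in both slots. -/
def balRel3 (B : Submodule k A) : Submodule k ((A ⊗[k] A) ⊗[k] A) :=
  Submodule.span k
    ({z | ∃ (a a' c : A) (b : B),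
        z = ((a * (b : A)) ⊗ₜ[k] a') ⊗ₜ[k] c -
          (a ⊗ₜ[k] ((b : A) * a')) ⊗ₜ[k] c} ∪
      {z | ∃ (a a' c : A) (b : B),
        z = (a ⊗ₜ[k] (a' * (b : A))) ⊗ₜ[k] c -
          (a ⊗ₜ[k] a') ⊗ₜ[k] ((b : A) * c)})

/-- The triple balanced tensor product `A ⊗_B A ⊗_B A`. -/
abbrev TensorOver3 (B : Submodule k A) : Type _ :=
  ((A ⊗[k] A) ⊗[k] A) ⧸ balRel3 B

lemma pair12_rel (B : Submodule k A) :
    balRel (k := k) B ≤ LinearMap.ker (TensorProduct.curry (balRel3 B).mkQ) := by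
  refine Submodule.span_le.mpr ?_
  rintro z ⟨a, a', b, rfl⟩
  simp only [SetLike.mem_coe, LinearMap.mem_ker, map_sub]
  apply LinearMap.ext
  intro c
  simp only [LinearMap.sub_apply, LinearMap.zero_apply,
    TensorProduct.curry_apply]
  rw [← map_sub, Submodule.mkQ_apply, Submodule.Quotient.mk_eq_zero]
  apply Submodule.subset_span
  exact Set.mem_union_left _ ⟨a, a', c, b, rfl⟩

/-- Pairing `A ⊗_B A → (A → A ⊗_B A ⊗_B A)`, `(x ⊗ x') ↦ (c ↦ x ⊗ x' ⊗ c)`. -/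
def pair12 (B : Submodule k A) :
    TensorOver (k := k) B →ₗ[k] A →ₗ[k] TensorOver3 (k := k) B :=
  Submodule.liftQ _ (TensorProduct.curry (balRel3 B).mkQ) (pair12_rel B)

lemma pair23_rel (B : Submodule k A) (a : A) :
    balRel (k := k) B ≤ LinearMap.ker
      (TensorProduct.curry ((balRel3 B).mkQ ∘ₗ
        (TensorProduct.assoc k A A A).symm.toLinearMap) a) := by
  refine Submodule.span_le.mpr ?_
  rintro z ⟨x, y, b, rfl⟩
  simp only [SetLike.mem_coe, LinearMap.mem_ker, map_sub,
    TensorProduct.curry_apply, LinearMap.coe_comp, Function.comp_apply,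
    LinearEquiv.coe_coe, TensorProduct.assoc_symm_tmul]
  rw [← map_sub, Submodule.mkQ_apply, Submodule.Quotient.mk_eq_zero]
  apply Submodule.subset_span
  exact Set.mem_union_right _ ⟨a, x, y, b, rfl⟩

/-- Pairing `A → (A ⊗_B A → A ⊗_B A ⊗_B A)`, `a ↦ (x ⊗ x' ↦ a ⊗ x ⊗ x')`. -/
def pair23 (B : Submodule k A) :
    A →ₗ[k] TensorOver (k := k) B →ₗ[k] TensorOver3 (k := k) B where
  toFun a := Submodule.liftQ _
    (TensorProduct.curry ((balRel3 B).mkQ ∘ₗ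
      (TensorProduct.assoc k A A A).symm.toLinearMap) a) (pair23_rel B a)
  map_add' a a' := by
    apply Submodule.linearMap_qext
    simp only [Submodule.liftQ_mkQ, LinearMap.add_comp, map_add]
  map_smul' c a := by
    apply Submodule.linearMap_qext
    simp only [RingHom.id_apply, Submodule.liftQ_mkQ, LinearMap.smul_comp,
      map_smul]

end S16defs

section BraidingProof

variable {k : Type*} [CommRing k]
variable {A : Type*} [Ring A] [Algebra k A]
variable {R : Type*} [Ring R] [Algebra k R]

lemma mk_mul_tmul (B : Submodule k A) (a a' : A) {b : A} (hb : b ∈ B) :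
    (balRel B).mkQ ((a * b) ⊗ₜ[k] a') = (balRel B).mkQ (a ⊗ₜ[k] (b * a')) := by
  rw [← sub_eq_zero, ← map_sub, Submodule.mkQ_apply, Submodule.Quotient.mk_eq_zero]
  exact Submodule.subset_span ⟨a, a', ⟨b, hb⟩, rfl⟩

lemma tensorOver_induction {B : Submodule k A} {p : TensorOver (k := k) B → Prop}
    (t : TensorOver (k := k) B) (zero : p 0)
    (mk : ∀ a a' : A, p ((balRel B).mkQ (a ⊗ₜ[k] a')))
    (add : ∀ x y, p x → p y → p (x + y)) : p t := by
  obtain ⟨z, rfl⟩ := (balRel B).mkQ_surjective t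
  induction z using TensorProduct.induction_on with
  | zero => simpa using zero
  | tmul a a' => exact mk a a'
  | add x y hx hy => rw [map_add]; exact add _ _ hx hy

@[simp] lemma lmulQ_mk (B : Submodule k A) (x a a' : A) :
    lmulQ B x ((balRel B).mkQ (a ⊗ₜ[k] a')) = (balRel B).mkQ ((x * a) ⊗ₜ[k] a') := rfl

@[simp] lemma rmulQ_mk (B : Submodule k A) (x a a' : A) :
    rmulQ B x ((balRel B).mkQ (a ⊗ₜ[k] a')) = (balRel B).mkQ (a ⊗ₜ[k] (a' * x)) := rfl

@[simp] lemma pair12_mk (B : Submodule k A) (a a' c : A) :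
    pair12 B ((balRel B).mkQ (a ⊗ₜ[k] a')) c = (balRel3 B).mkQ ((a ⊗ₜ[k] a') ⊗ₜ[k] c) := rfl

@[simp] lemma pair23_mk (B : Submodule k A) (a a' c : A) :
    pair23 B a ((balRel B).mkQ (a' ⊗ₜ[k] c)) = (balRel3 B).mkQ ((a ⊗ₜ[k] a') ⊗ₜ[k] c) := rfl

lemma mk_mul_left_tmul (B : Submodule k A) (a a' c : A) {b : A} (hb : b ∈ B) :
    (balRel3 B).mkQ (((a * b) ⊗ₜ[k] a') ⊗ₜ[k] c) =
      (balRel3 B).mkQ ((a ⊗ₜ[k] (b * a')) ⊗ₜ[k] c) := by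
  rw [← pair12_mk, mk_mul_tmul B a a' hb, pair12_mk]

lemma mk_mul_right_tmul (B : Submodule k A) (a a' c : A) {b : A} (hb : b ∈ B) :
    (balRel3 B).mkQ ((a ⊗ₜ[k] (a' * b)) ⊗ₜ[k] c) =
      (balRel3 B).mkQ ((a ⊗ₜ[k] a') ⊗ₜ[k] (b * c)) := by
  rw [← pair23_mk, mk_mul_tmul B a' c hb, pair23_mk]

/-- Right multiplication by `b ∈ B` on `A ⊗_B A` can be moved across `⊗_B`. -/
lemma pair12_rmulQ (B : Submodule k A) (t : TensorOver (k := k) B) {b : A} (hb : b ∈ B) (c : A) :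
    pair12 B (rmulQ B b t) c = pair12 B t (b * c) := by
  induction t using tensorOver_induction with
  | zero => simp
  | mk a a' => simp only [rmulQ_mk, pair12_mk, mk_mul_right_tmul B a a' c hb]
  | add x y hx hy => simp only [map_add, LinearMap.add_apply, hx, hy]

/-- Left multiplication by `b ∈ B` on `A ⊗_B A` can be moved across `⊗_B`. -/
lemma pair23_mul (B : Submodule k A) (t : TensorOver (k := k) B) {b : A} (hb : b ∈ B) (a : A) :
    pair23 B (a * b) t = pair23 B a (lmulQ B b t) := by
  induction t using tensorOver_induction with
  | zero => simp
  | mk a' c => simp only [lmulQ_mk, pair23_mk, mk_mul_left_tmul B a a' c hb]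
  | add x y hx hy => simp only [map_add, hx, hy]

/-- A linear map out of `(A ⊗ A) ⊗ A` compatible with `B` vanishes on the balanced relations. -/
lemma balRel3_le_ker {N : Type*} [AddCommGroup N] [Module k N] (B : Submodule k A)
    (F : (A ⊗[k] A) ⊗[k] A →ₗ[k] N)
    (h₁ : ∀ a a' c, ∀ b ∈ B, F (((a * b) ⊗ₜ a') ⊗ₜ c) = F ((a ⊗ₜ (b * a')) ⊗ₜ c))
    (h₂ : ∀ a a' c, ∀ b ∈ B, F ((a ⊗ₜ (a' * b)) ⊗ₜ c) = F ((a ⊗ₜ a') ⊗ₜ (b * c))) :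
    balRel3 B ≤ LinearMap.ker F := by
  refine Submodule.span_le.mpr ?_
  rintro z (⟨a, a', c, b, rfl⟩ | ⟨a, a', c, b, rfl⟩)
  · simp only [SetLike.mem_coe, LinearMap.mem_ker, map_sub, h₁ a a' c b b.2, sub_self]
  · simp only [SetLike.mem_coe, LinearMap.mem_ker, map_sub, h₂ a a' c b b.2, sub_self]

lemma balRel_le_ker {N : Type*} [AddCommGroup N] [Module k N] (B : Submodule k A)
    (F : A ⊗[k] A →ₗ[k] N)
    (h : ∀ a a', ∀ b ∈ B, F ((a * b) ⊗ₜ a') = F (a ⊗ₜ (b * a'))) :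
    balRel B ≤ LinearMap.ker F := by
  refine Submodule.span_le.mpr ?_
  rintro z ⟨a, a', b, rfl⟩
  simp only [SetLike.mem_coe, LinearMap.mem_ker, map_sub, h a a' b b.2, sub_self]

lemma tensorOver3_hom_ext {N : Type*} [AddCommGroup N] [Module k N] {B : Submodule k A}
    {F G : TensorOver3 (k := k) B →ₗ[k] N}
    (h : ∀ a b c : A, F ((balRel3 B).mkQ ((a ⊗ₜ b) ⊗ₜ c)) = G ((balRel3 B).mkQ ((a ⊗ₜ b) ⊗ₜ c))) :
    F = G := by
  apply Submodule.linearMap_qext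
  apply TensorProduct.ext_threefold
  exact h

/-- The product `a ⊗ b ⊗ c ↦ f(a) g(b) h(c)` on `A ⊗ A ⊗ A`. -/
def tripleMulAux (f g h : A →ₐ[k] R) : (A ⊗[k] A) ⊗[k] A →ₗ[k] R :=
  LinearMap.mul' k R ∘ₗ TensorProduct.map
    (LinearMap.mul' k R ∘ₗ TensorProduct.map f.toLinearMap g.toLinearMap) h.toLinearMap

lemma tripleMulAux_rel {B : Submodule k A} {f g h : A →ₐ[k] R}
    (hfg : ∀ b ∈ B, f b = g b) (hgh : ∀ b ∈ B, g b = h b) :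
    balRel3 B ≤ LinearMap.ker (tripleMulAux f g h) := by
  apply balRel3_le_ker
  · intro a a' c b hb
    simp [tripleMulAux, hfg b hb, mul_assoc]
  · intro a a' c b hb
    simp [tripleMulAux, hgh b hb, mul_assoc]

/-- The product `a ⊗ b ⊗ c ↦ f(a) g(b) h(c)` on `A ⊗_B A ⊗_B A`, for algebra maps that agree
on `B`. -/
def tripleMul {B : Submodule k A} {f g h : A →ₐ[k] R}
    (hfg : ∀ b ∈ B, f b = g b) (hgh : ∀ b ∈ B, g b = h b) : TensorOver3 (k := k) B →ₗ[k] R :=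
  Submodule.liftQ _ (tripleMulAux f g h) (tripleMulAux_rel hfg hgh)

@[simp] lemma tripleMul_mk {B : Submodule k A} {f g h : A →ₐ[k] R}
    (hfg : ∀ b ∈ B, f b = g b) (hgh : ∀ b ∈ B, g b = h b) (a b c : A) :
    tripleMul hfg hgh ((balRel3 B).mkQ ((a ⊗ₜ[k] b) ⊗ₜ[k] c)) = f a * g b * h c := rfl

variable {H : Type*} [Ring H]

section Canonical

variable [Bialgebra k H] (S : ComodAlg k H A)

/-- The inclusion `a ↦ a ⊗ 1` of a comodule algebra in `A ⊗ H`. -/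
def ComodAlg.incl (_S : ComodAlg k H A) : A →ₐ[k] A ⊗[k] H :=
  Algebra.TensorProduct.includeLeft

lemma ComodAlg.incl_apply (a : A) : S.incl a = a ⊗ₜ[k] (1 : H) := rfl

lemma ComodAlg.ρ_of_mem {b : A} (hb : b ∈ S.coinv) : S.ρ b = S.incl b := hb

/-- The algebra map `id ⊗ ε : A ⊗ H → A`. -/
def ComodAlg.counitRight (_S : ComodAlg k H A) : A ⊗[k] H →ₐ[k] A :=
  (Algebra.TensorProduct.rid k k A).toAlgHom.comp
    (Algebra.TensorProduct.map (AlgHom.id k A) (Bialgebra.counitAlgHom k H))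

lemma ComodAlg.counitRight_incl (a : A) : S.counitRight (S.incl a) = a := by
  simp [counitRight, incl]

lemma ComodAlg.counitRight_ρ (a : A) : S.counitRight (S.ρ a) = a := by
  have h := LinearMap.congr_fun S.coaction.1 a
  have h' : TensorProduct.rid k A
      (LinearMap.lTensor A (Coalgebra.counit (R := k) (A := H)) (S.ρ a)) = a := by
    simpa using congrArg (TensorProduct.rid k A) h
  exact h'

/-- The algebra map `a ⊗ h ↦ a ⊗ h ⊗ 1`. -/
def ComodAlg.leg12 (_S : ComodAlg k H A) : A ⊗[k] H →ₐ[k] (A ⊗[k] H) ⊗[k] H :=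
  Algebra.TensorProduct.includeLeft

/-- The algebra map `ρ ⊗ id : A ⊗ H → A ⊗ H ⊗ H`. -/
def ComodAlg.leg23 : A ⊗[k] H →ₐ[k] (A ⊗[k] H) ⊗[k] H :=
  Algebra.TensorProduct.map S.ρ (AlgHom.id k H)

/-- The algebra map `id ⊗ Δ : A ⊗ H → A ⊗ H ⊗ H`. -/
def ComodAlg.leg13 (_S : ComodAlg k H A) : A ⊗[k] H →ₐ[k] (A ⊗[k] H) ⊗[k] H :=
  (Algebra.TensorProduct.assoc k k k A H H).symm.toAlgHom.comp
    (Algebra.TensorProduct.map (AlgHom.id k A) (Bialgebra.comulAlgHom k H))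

lemma ComodAlg.leg23_incl (a : A) : S.leg23 (S.incl a) = S.leg12 (S.ρ a) := by
  simp [leg23, leg12, incl]

lemma ComodAlg.leg13_incl (a : A) : S.leg13 (S.incl a) = S.leg12 (S.incl a) := by
  simp [leg13, leg12, incl, Algebra.TensorProduct.one_def]

lemma ComodAlg.assoc_leg23_ρ (a : A) :
    TensorProduct.assoc k A H H (LinearMap.rTensor H S.ρ.toLinearMap (S.ρ a)) =
      LinearMap.lTensor A (Coalgebra.comul (R := k) (A := H)) (S.ρ a) :=
  LinearMap.congr_fun S.coaction.2 a

lemma ComodAlg.leg13_ρ (a : A) : S.leg13 (S.ρ a) = S.leg23 (S.ρ a) :=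
  (TensorProduct.assoc k A H H).symm_apply_eq.2 (S.assoc_leg23_ρ a).symm

lemma chiAux_tmul (a a' : A) : chiAux S (a ⊗ₜ a') = S.incl a * S.ρ a' := rfl

variable (hχ : balRel S.coinv ≤ LinearMap.ker (chiAux S))

lemma chiQ_mk (a a' : A) :
    chiQ S hχ ((balRel S.coinv).mkQ (a ⊗ₜ a')) = S.incl a * S.ρ a' := rfl

lemma chiQ_lmulQ (x : A) (t : TensorOver (k := k) S.coinv) :
    chiQ S hχ (lmulQ S.coinv x t) = S.incl x * chiQ S hχ t := by
  induction t using tensorOver_induction with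
  | zero => simp
  | mk a a' => simp only [lmulQ_mk, chiQ_mk, map_mul, mul_assoc]
  | add x y hx hy => simp only [map_add, mul_add, hx, hy]

lemma chiQ_rmulQ (x : A) (t : TensorOver (k := k) S.coinv) :
    chiQ S hχ (rmulQ S.coinv x t) = chiQ S hχ t * S.ρ x := by
  induction t using tensorOver_induction with
  | zero => simp
  | mk a a' => simp only [rmulQ_mk, chiQ_mk, map_mul, mul_assoc]
  | add x y hx hy => simp only [map_add, add_mul, hx, hy]

lemma ComodAlg.IsHopfGalois.bijective_chiQ {S : ComodAlg k H A} (h : S.IsHopfGalois) :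
    Function.Bijective (chiQ S h.2.ge) := by
  constructor
  · rw [← LinearMap.ker_eq_bot, chiQ, Submodule.ker_liftQ_eq_bot']
    exact h.2.symm
  · intro y
    obtain ⟨z, rfl⟩ := h.1 y
    exact ⟨(balRel S.coinv).mkQ z, rfl⟩

lemma ComodAlg.incl_eq_ρ : ∀ b ∈ S.coinv, S.incl b = S.ρ b := fun _ hb => (S.ρ_of_mem hb).symm

/-- The product map `a ⊗ b ⊗ c ↦ a b₍₀₎ c₍₀₎ ⊗ b₍₁₎ c₍₁₎ ⊗ c₍₂₎`, the canonical map on the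
triple balanced tensor product. -/
def chi3 : TensorOver3 (k := k) S.coinv →ₗ[k] (A ⊗[k] H) ⊗[k] H :=
  tripleMul (f := S.leg12.comp S.incl) (g := S.leg12.comp S.ρ) (h := S.leg23.comp S.ρ)
    (fun b hb => by simp [S.ρ_of_mem hb])
    (fun b hb => by simp [S.ρ_of_mem hb, S.leg23_incl])

lemma chi3_mk (a b c : A) :
    chi3 S ((balRel3 S.coinv).mkQ ((a ⊗ₜ b) ⊗ₜ c)) =
      S.leg12 (S.incl a) * S.leg12 (S.ρ b) * S.leg23 (S.ρ c) := rfl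

/-- The pairing `x ⊗_B y ↦ (g ↦ x ⊗_B N (y ⊗ g))` for a left `B`-linear map
`N : A ⊗ H → A ⊗_B A`. -/
def pairN (B : Submodule k A) (N : A ⊗[k] H →ₗ[k] TensorOver (k := k) B)
    (hN : ∀ b ∈ B, ∀ y g, N ((b * y) ⊗ₜ g) = lmulQ B b (N (y ⊗ₜ g))) :
    TensorOver (k := k) B →ₗ[k] H →ₗ[k] TensorOver3 (k := k) B :=
  Submodule.liftQ _
    (TensorProduct.lift
      ((LinearMap.llcomp k H (TensorOver (k := k) B) (TensorOver3 (k := k) B) ∘ₗ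
        pair23 B).compl₂ (TensorProduct.curry N)))
    (balRel_le_ker B _ fun a a' b hb => by
      ext g
      simp [hN b hb, pair23_mul B _ hb])

lemma chi3_injective (h : S.IsHopfGalois) : Function.Injective (chi3 S) := by
  set e := LinearEquiv.ofBijective _ h.bijective_chiQ with he
  have hN : ∀ b y, ∀ g : H, e.symm ((b * y) ⊗ₜ g) = lmulQ S.coinv b (e.symm (y ⊗ₜ g)) := by
    intro b y g
    rw [LinearEquiv.symm_apply_eq, he, LinearEquiv.ofBijective_apply, chiQ_lmulQ,
      ← LinearEquiv.ofBijective_apply (hf := h.bijective_chiQ), ← he, e.apply_symm_apply,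
      S.incl_apply, Algebra.TensorProduct.tmul_mul_tmul, one_mul]
  have hN' : ∀ b v, e.symm (S.incl b * v) = lmulQ S.coinv b (e.symm v) := by
    intro b v
    induction v using TensorProduct.induction_on with
    | zero => simp
    | tmul y g => rw [← hN, S.incl_apply, Algebra.TensorProduct.tmul_mul_tmul, one_mul]
    | add x y hx hy => simp only [mul_add, map_add, hx, hy]
  set P := pairN S.coinv e.symm.toLinearMap (fun b _ => hN b) with hP
  have key : ∀ a b v, TensorProduct.lift (P ∘ₗ e.symm.toLinearMap)
      (S.leg12 (S.incl a) * S.leg12 (S.ρ b) * S.leg23 v) =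
        pair23 S.coinv a (lmulQ S.coinv b (e.symm v)) := by
    intro a b v
    induction v using TensorProduct.induction_on with
    | zero => simp
    | tmul u g =>
      have h1 : S.leg12 (S.incl a) * S.leg12 (S.ρ b) * S.leg23 (u ⊗ₜ g) =
          e ((balRel S.coinv).mkQ (a ⊗ₜ (b * u))) ⊗ₜ[k] g := by
        rw [he, LinearEquiv.ofBijective_apply, chiQ_mk]
        simp [ComodAlg.leg12, ComodAlg.leg23, mul_assoc]
      rw [h1, TensorProduct.lift.tmul, LinearMap.comp_apply, LinearEquiv.coe_coe,
        e.symm_apply_apply, ← hN]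
      rfl
    | add x y hx hy => simp only [mul_add, map_add, hx, hy]
  have hid : TensorProduct.lift (P ∘ₗ e.symm.toLinearMap) ∘ₗ chi3 S = LinearMap.id := by
    apply tensorOver3_hom_ext
    intro a b c
    have hc : e.symm (S.ρ c) = (balRel S.coinv).mkQ (1 ⊗ₜ c) := by
      rw [LinearEquiv.symm_apply_eq, he, LinearEquiv.ofBijective_apply, chiQ_mk, map_one, one_mul]
    rw [LinearMap.comp_apply, chi3_mk, key, hc, lmulQ_mk, mul_one, pair23_mk, LinearMap.id_apply]
  exact Function.LeftInverse.injective fun x => LinearMap.congr_fun hid x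

/-- The map `a ⊗ a' ↦ a₍₀₎ a' ⊗ a₍₁₎` on `A ⊗_B A`. -/
def chiFlip : TensorOver (k := k) S.coinv →ₗ[k] A ⊗[k] H :=
  Submodule.liftQ _
    (LinearMap.mul' k (A ⊗[k] H) ∘ₗ TensorProduct.map S.ρ.toLinearMap S.incl.toLinearMap)
    (balRel_le_ker _ _ fun a a' b hb => by simp [S.ρ_of_mem hb, mul_assoc])

lemma chiFlip_mk (a a' : A) :
    chiFlip S ((balRel S.coinv).mkQ (a ⊗ₜ a')) = S.ρ a * S.incl a' := rfl

lemma chiFlip_rmulQ (x : A) (t : TensorOver (k := k) S.coinv) :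
    chiFlip S (rmulQ S.coinv x t) = chiFlip S t * S.incl x := by
  induction t using tensorOver_induction with
  | zero => simp
  | mk a a' => simp only [rmulQ_mk, chiFlip_mk, map_mul, mul_assoc]
  | add x y hx hy => simp only [map_add, add_mul, hx, hy]

lemma chiFlip_lmulQ (x : A) (t : TensorOver (k := k) S.coinv) :
    chiFlip S (lmulQ S.coinv x t) = S.ρ x * chiFlip S t := by
  induction t using tensorOver_induction with
  | zero => simp
  | mk a a' => simp only [lmulQ_mk, chiFlip_mk, map_mul, mul_assoc]
  | add x y hx hy => simp only [map_add, mul_add, hx, hy]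

/-- The map `a ⊗ h ↦ a₍₀₎ ⊗ m(a₍₁₎ ⊗ h)`. -/
def ComodAlg.twist (m : H ⊗[k] H →ₗ[k] H) : A ⊗[k] H →ₗ[k] A ⊗[k] H :=
  LinearMap.lTensor A m ∘ₗ (TensorProduct.assoc k A H H).toLinearMap ∘ₗ
    LinearMap.rTensor H S.ρ.toLinearMap

lemma ComodAlg.twist_tmul (m : H ⊗[k] H →ₗ[k] H) (a : A) (h : H) :
    S.twist m (a ⊗ₜ h) =
      LinearMap.lTensor A (m ∘ₗ (TensorProduct.mk k H H).flip h) (S.ρ a) := by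
  simp only [twist, LinearMap.comp_apply, LinearMap.rTensor_tmul]
  change LinearMap.lTensor A m (TensorProduct.assoc k A H H (S.ρ a ⊗ₜ h)) = _
  induction S.ρ a using TensorProduct.induction_on with
  | zero => simp
  | tmul u g => simp
  | add x y hx hy => rw [TensorProduct.add_tmul, map_add, map_add, map_add, hx, hy]

lemma ComodAlg.twist_ρ {m : H ⊗[k] H →ₗ[k] H}
    (hm : m ∘ₗ Coalgebra.comul (R := k) (A := H) =
      Algebra.linearMap k H ∘ₗ Coalgebra.counit (R := k) (A := H)) (a : A) :
    S.twist m (S.ρ a) = S.incl a := by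
  have h1 : S.twist m (S.ρ a) =
      LinearMap.lTensor A (m ∘ₗ Coalgebra.comul (R := k) (A := H)) (S.ρ a) := by
    rw [twist, LinearMap.comp_apply, LinearMap.comp_apply, LinearEquiv.coe_coe,
      S.assoc_leg23_ρ, LinearMap.lTensor_comp, LinearMap.comp_apply]
  have h2 := LinearMap.congr_fun S.coaction.1 a
  simp only [LinearMap.comp_apply, AlgHom.toLinearMap_apply, LinearMap.flip_apply,
    TensorProduct.mk_apply] at h2
  rw [h1, hm, LinearMap.lTensor_comp, LinearMap.comp_apply, h2]
  simp [incl]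

/-- If `m (x y ⊗ h) = x m (y ⊗ h)` and `m ∘ Δ = η ∘ ε`, then twisting by `m` turns the canonical
map into its flipped version. -/
lemma twist_chiQ {m : H ⊗[k] H →ₗ[k] H}
    (hm : m ∘ₗ Coalgebra.comul (R := k) (A := H) =
      Algebra.linearMap k H ∘ₗ Coalgebra.counit (R := k) (A := H))
    (hmul : ∀ x y h, m ((x * y) ⊗ₜ h) = x * m (y ⊗ₜ h)) (t : TensorOver (k := k) S.coinv) :
    S.twist m (chiQ S hχ t) = chiFlip S t := by
  have key : ∀ a w, S.twist m (S.incl a * w) = S.ρ a * S.twist m w := by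
    intro a w
    induction w using TensorProduct.induction_on with
    | zero => simp
    | tmul u h =>
      rw [S.incl_apply, Algebra.TensorProduct.tmul_mul_tmul, one_mul, S.twist_tmul, S.twist_tmul,
        map_mul]
      induction S.ρ a using TensorProduct.induction_on with
      | zero => simp
      | tmul p q =>
        induction S.ρ u using TensorProduct.induction_on with
        | zero => simp
        | tmul r s => simp [hmul]
        | add x y hx hy => simp only [mul_add, map_add, hx, hy]
      | add x y hx hy => simp only [add_mul, map_add, hx, hy]
    | add x y hx hy => simp only [mul_add, map_add, hx, hy]
  induction t using tensorOver_induction with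
  | zero => simp
  | mk a a' => rw [chiQ_mk, key, S.twist_ρ hm, chiFlip_mk]
  | add x y hx hy => simp only [map_add, hx, hy]

/-- If `m (x y ⊗ h) = m (x ⊗ h) y` and `m ∘ Δ = η ∘ ε`, then twisting by `m` turns the flipped
canonical map into the canonical map. -/
lemma twist_chiFlip {m : H ⊗[k] H →ₗ[k] H}
    (hm : m ∘ₗ Coalgebra.comul (R := k) (A := H) =
      Algebra.linearMap k H ∘ₗ Coalgebra.counit (R := k) (A := H))
    (hmul : ∀ x y h, m ((x * y) ⊗ₜ h) = m (x ⊗ₜ h) * y) (t : TensorOver (k := k) S.coinv) :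
    S.twist m (chiFlip S t) = chiQ S hχ t := by
  have key : ∀ a w, S.twist m (w * S.incl a) = S.twist m w * S.ρ a := by
    intro a w
    induction w using TensorProduct.induction_on with
    | zero => simp
    | tmul u h =>
      rw [S.incl_apply, Algebra.TensorProduct.tmul_mul_tmul, mul_one, S.twist_tmul, S.twist_tmul,
        map_mul]
      induction S.ρ a using TensorProduct.induction_on with
      | zero => simp
      | tmul p q =>
        induction S.ρ u using TensorProduct.induction_on with
        | zero => simp
        | tmul r s => simp [hmul]
        | add x y hx hy => simp only [add_mul, map_add, hx, hy]
      | add x y hx hy => simp only [mul_add, map_add, hx, hy]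
    | add x y hx hy => simp only [add_mul, map_add, hx, hy]
  induction t using tensorOver_induction with
  | zero => simp
  | mk a a' => rw [chiFlip_mk, key, S.twist_ρ hm, chiQ_mk]
  | add x y hx hy => simp only [map_add, hx, hy]

/-- A triple product whose first two maps are restrictions of `p : A ⊗ H → R` depends on the
first two legs only through the canonical map. -/
lemma tripleMul_pair12 {f g h : A →ₐ[k] R} (hfg : ∀ b ∈ S.coinv, f b = g b)
    (hgh : ∀ b ∈ S.coinv, g b = h b) (p : A ⊗[k] H →ₐ[k] R)
    (hf : ∀ a, p (S.incl a) = f a) (hg : ∀ a, p (S.ρ a) = g a)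
    (t : TensorOver (k := k) S.coinv) (c : A) :
    tripleMul hfg hgh (pair12 S.coinv t c) = p (chiQ S hχ t) * h c := by
  induction t using tensorOver_induction with
  | zero => simp
  | mk a a' => rw [pair12_mk, tripleMul_mk, chiQ_mk, map_mul, hf, hg]
  | add x y hx hy => simp only [map_add, LinearMap.add_apply, add_mul, hx, hy]

/-- A triple product whose last two maps are restrictions of `p : A ⊗ H → R` depends on the
last two legs only through the canonical map. -/
lemma tripleMul_pair23 {f g h : A →ₐ[k] R} (hfg : ∀ b ∈ S.coinv, f b = g b)
    (hgh : ∀ b ∈ S.coinv, g b = h b) (p : A ⊗[k] H →ₐ[k] R)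
    (hg : ∀ a, p (S.incl a) = g a) (hh : ∀ a, p (S.ρ a) = h a)
    (a : A) (t : TensorOver (k := k) S.coinv) :
    tripleMul hfg hgh (pair23 S.coinv a t) = f a * p (chiQ S hχ t) := by
  induction t using tensorOver_induction with
  | zero => simp
  | mk a a' => rw [pair23_mk, tripleMul_mk, chiQ_mk, map_mul, hg, hh, mul_assoc]
  | add x y hx hy => simp only [map_add, mul_add, hx, hy]

section Exchange

variable {σ : TensorOver (k := k) S.coinv →ₗ[k] TensorOver (k := k) S.coinv}
variable (hσ : ∀ t, chiQ S hχ (σ t) = chiFlip S t)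
variable {f g h : A →ₐ[k] R}

include hσ in
/-- `σ₁₂` exchanges the first two maps of a triple product. -/
lemma tripleMul_comp_braid12 (p : A ⊗[k] H →ₐ[k] R)
    (hf : ∀ a, p (S.incl a) = f a) (hg : ∀ a, p (S.ρ a) = g a)
    (hfg : ∀ b ∈ S.coinv, f b = g b) (hgh : ∀ b ∈ S.coinv, g b = h b)
    (hfh : ∀ b ∈ S.coinv, f b = h b)
    {σ12 : TensorOver3 (k := k) S.coinv →ₗ[k] TensorOver3 (k := k) S.coinv}
    (hσ12 : σ12 ∘ₗ (balRel3 S.coinv).mkQ =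
      TensorProduct.lift (pair12 S.coinv) ∘ₗ LinearMap.rTensor A (σ ∘ₗ (balRel S.coinv).mkQ)) :
    tripleMul hfg hgh ∘ₗ σ12 = tripleMul (fun b hb => (hfg b hb).symm) hfh := by
  apply tensorOver3_hom_ext
  intro a b c
  have h1 : σ12 ((balRel3 S.coinv).mkQ ((a ⊗ₜ b) ⊗ₜ c)) =
      pair12 S.coinv (σ ((balRel S.coinv).mkQ (a ⊗ₜ b))) c :=
    LinearMap.congr_fun hσ12 ((a ⊗ₜ b) ⊗ₜ c)
  rw [LinearMap.comp_apply, h1, tripleMul_pair12 S hχ hfg hgh p hf hg, hσ, chiFlip_mk, map_mul,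
    hf, hg, tripleMul_mk]

include hσ in
/-- `σ₂₃` exchanges the last two maps of a triple product. -/
lemma tripleMul_comp_braid23 (p : A ⊗[k] H →ₐ[k] R)
    (hg : ∀ a, p (S.incl a) = g a) (hh : ∀ a, p (S.ρ a) = h a)
    (hfg : ∀ b ∈ S.coinv, f b = g b) (hgh : ∀ b ∈ S.coinv, g b = h b)
    (hfh : ∀ b ∈ S.coinv, f b = h b)
    {σ23 : TensorOver3 (k := k) S.coinv →ₗ[k] TensorOver3 (k := k) S.coinv}
    (hσ23 : σ23 ∘ₗ (balRel3 S.coinv).mkQ =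
      TensorProduct.lift (pair23 S.coinv) ∘ₗ LinearMap.lTensor A (σ ∘ₗ (balRel S.coinv).mkQ) ∘ₗ
        (TensorProduct.assoc k A A A).toLinearMap) :
    tripleMul hfg hgh ∘ₗ σ23 = tripleMul hfh (fun b hb => (hgh b hb).symm) := by
  apply tensorOver3_hom_ext
  intro a b c
  have h1 : σ23 ((balRel3 S.coinv).mkQ ((a ⊗ₜ b) ⊗ₜ c)) =
      pair23 S.coinv a (σ ((balRel S.coinv).mkQ (b ⊗ₜ c))) :=
    LinearMap.congr_fun hσ23 ((a ⊗ₜ b) ⊗ₜ c)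
  rw [LinearMap.comp_apply, h1, tripleMul_pair23 S hχ hfg hgh p hg hh, hσ, chiFlip_mk, map_mul,
    hg, hh, tripleMul_mk, mul_assoc]

end Exchange

end Canonical

section Translation

variable [HopfAlgebra k H] (S : ComodAlg k H A) (hχ : balRel S.coinv ≤ LinearMap.ker (chiAux S))

open HopfAlgebra

lemma twist_antipode_chiQ (t : TensorOver (k := k) S.coinv) :
    S.twist (LinearMap.mul' k H ∘ₗ LinearMap.lTensor H (antipode k)) (chiQ S hχ t) =
      chiFlip S t :=
  twist_chiQ S hχ mul_antipode_lTensor_comul (fun x y h => by simp [mul_assoc]) t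

lemma mul_antipodeInv_comul {Sinv : H →ₗ[k] H}
    (hSinv1 : Sinv ∘ₗ antipode k = LinearMap.id) (hSinv2 : antipode k ∘ₗ Sinv = LinearMap.id) :
    (LinearMap.mul' k H ∘ₗ (TensorProduct.comm k H H).toLinearMap ∘ₗ LinearMap.lTensor H Sinv) ∘ₗ
      Coalgebra.comul (R := k) (A := H) =
    Algebra.linearMap k H ∘ₗ Coalgebra.counit (R := k) (A := H) := by
  have hinj : Function.Injective (antipode k : H →ₗ[k] H) :=
    Function.LeftInverse.injective fun x => LinearMap.congr_fun hSinv1 x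
  have h1 : antipode k ∘ₗ LinearMap.mul' k H ∘ₗ (TensorProduct.comm k H H).toLinearMap ∘ₗ
      LinearMap.lTensor H Sinv = LinearMap.mul' k H ∘ₗ LinearMap.rTensor H (antipode k) := by
    ext x y
    have hy : antipode k (Sinv y) = y := LinearMap.congr_fun hSinv2 y
    simp [antipode_mul_antidistrib, hy]
  ext x
  apply hinj
  have h2 := LinearMap.congr_fun h1 (Coalgebra.comul (R := k) x)
  have h3 := mul_antipode_rTensor_comul_apply (R := k) x
  simp only [LinearMap.comp_apply] at h2 ⊢
  rw [h2, h3]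
  simp [Algebra.algebraMap_eq_smul_one]

lemma chiFlip_injective {Sinv : H →ₗ[k] H} (hG : S.IsHopfGalois)
    (hSinv1 : Sinv ∘ₗ antipode k = LinearMap.id) (hSinv2 : antipode k ∘ₗ Sinv = LinearMap.id) :
    Function.Injective (chiFlip S) := by
  intro s t hst
  apply hG.bijective_chiQ.1
  have hmul : ∀ x y h : H,
      (LinearMap.mul' k H ∘ₗ (TensorProduct.comm k H H).toLinearMap ∘ₗ LinearMap.lTensor H Sinv)
        ((x * y) ⊗ₜ h) =
      (LinearMap.mul' k H ∘ₗ (TensorProduct.comm k H H).toLinearMap ∘ₗ LinearMap.lTensor H Sinv)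
        (x ⊗ₜ h) * y := fun x y h => by simp [mul_assoc]
  rw [← twist_chiFlip S hG.2.ge (mul_antipodeInv_comul hSinv1 hSinv2) hmul s, hst,
    twist_chiFlip S hG.2.ge (mul_antipodeInv_comul hSinv1 hSinv2) hmul t]

variable {τ : H →ₗ[k] TensorOver (k := k) S.coinv}
variable (hτ : chiQ S hχ ∘ₗ τ = TensorProduct.mk k A H 1)

include hτ in
lemma chiQ_braidAux (z : A ⊗[k] A) :
    chiQ S hχ (braidAux S τ z) = chiFlip S ((balRel S.coinv).mkQ z) := by
  have hτ' : ∀ h, chiQ S hχ (τ h) = 1 ⊗ₜ h := LinearMap.congr_fun hτ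
  induction z using TensorProduct.induction_on with
  | zero => simp
  | tmul a a' =>
    rw [chiFlip_mk]
    simp only [braidAux, LinearMap.comp_apply, LinearMap.rTensor_tmul, AlgHom.toLinearMap_apply,
      LinearEquiv.coe_coe]
    induction S.ρ a using TensorProduct.induction_on with
    | zero => simp
    | tmul u h => simp [chiQ_lmulQ, hτ', S.incl_apply]
    | add x y hx hy => simp only [TensorProduct.add_tmul, map_add, add_mul, hx, hy]
  | add x y hx hy => simp only [map_add, hx, hy]

include hτ in
lemma chiFlip_braidInvAux {Sinv : H →ₗ[k] H} (hSinv2 : antipode k ∘ₗ Sinv = LinearMap.id)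
    (z : A ⊗[k] A) :
    chiFlip S (braidInvAux S Sinv τ z) = chiQ S hχ ((balRel S.coinv).mkQ z) := by
  have hτ' : ∀ h, chiFlip S (τ (Sinv h)) = 1 ⊗ₜ h := by
    intro h
    have h1 : chiQ S hχ (τ (Sinv h)) = 1 ⊗ₜ Sinv h := LinearMap.congr_fun hτ _
    have h2 : antipode k (Sinv h) = h := LinearMap.congr_fun hSinv2 h
    rw [← twist_antipode_chiQ S hχ, h1, S.twist_tmul, map_one, Algebra.TensorProduct.one_def]
    simp [h2]
  induction z using TensorProduct.induction_on with
  | zero => simp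
  | tmul a a' =>
    rw [chiQ_mk]
    simp only [braidInvAux, LinearMap.comp_apply, LinearMap.lTensor_tmul,
      AlgHom.toLinearMap_apply, LinearEquiv.coe_coe]
    induction S.ρ a' using TensorProduct.induction_on with
    | zero => simp
    | tmul u h => simp [chiFlip_rmulQ, hτ', S.incl_apply]
    | add x y hx hy => simp only [TensorProduct.tmul_add, map_add, mul_add, hx, hy]
  | add x y hx hy => simp only [map_add, hx, hy]

end Translation

end BraidingProof

/-- The Ðurđević braiding
`σ(a ⊗_B a') = a₍₀₎ a' (a₍₁₎)⟨1⟩ ⊗_B (a₍₁₎)⟨2⟩` of a quantum principal bundle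
is a bijective `B`-bimodule map with inverse
`σ⁻¹(a ⊗_B a') = τ(S⁻¹(a'₍₁₎)) a a'₍₀₎`; it satisfies the braid equation, `A`
is braided-commutative (`m_A ∘ σ = m_A`), and the two hexagon relations
hold. -/
theorem durdevic_braiding
    {k : Type*} [Field k] {H : Type*} [Ring H] [HopfAlgebra k H]
    (hS : Function.Bijective (HopfAlgebra.antipode (R := k) (A := H)))
    (Sinv : H →ₗ[k] H)
    (hSinv1 : Sinv ∘ₗ HopfAlgebra.antipode (R := k) (A := H) = LinearMap.id)
    (hSinv2 : HopfAlgebra.antipode (R := k) (A := H) ∘ₗ Sinv = LinearMap.id)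
    {A : Type*} [Ring A] [Algebra k A] (S : ComodAlg k H A) (hQPB : S.IsQPB)
    (τ : H →ₗ[k] TensorOver (k := k) S.coinv)
    (hτ : chiQ S hQPB.1.2.ge ∘ₗ τ = TensorProduct.mk k A H 1)
    (σ : TensorOver (k := k) S.coinv →ₗ[k] TensorOver (k := k) S.coinv)
    (hσ : σ ∘ₗ (balRel S.coinv).mkQ = braidAux S τ) :
    -- (i) `σ` is a bijective `B`-bimodule map with the stated inverse
    ((∃ σi : TensorOver (k := k) S.coinv →ₗ[k] TensorOver (k := k) S.coinv,
        σi ∘ₗ (balRel S.coinv).mkQ = braidInvAux S Sinv τ) ∧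
     (∀ σi : TensorOver (k := k) S.coinv →ₗ[k] TensorOver (k := k) S.coinv,
        σi ∘ₗ (balRel S.coinv).mkQ = braidInvAux S Sinv τ →
        (∀ t, σi (σ t) = t) ∧ (∀ t, σ (σi t) = t)) ∧
     (∀ b ∈ S.coinv, ∀ t, σ (lmulQ S.coinv b t) = lmulQ S.coinv b (σ t)) ∧
     (∀ b ∈ S.coinv, ∀ t, σ (rmulQ S.coinv b t) = rmulQ S.coinv b (σ t))) ∧
    -- the induced maps on the triple balanced product exist ...
    ((∃ σ12 : TensorOver3 (k := k) S.coinv →ₗ[k] TensorOver3 (k := k) S.coinv,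
        σ12 ∘ₗ (balRel3 S.coinv).mkQ =
          TensorProduct.lift (pair12 S.coinv) ∘ₗ
            LinearMap.rTensor A (σ ∘ₗ (balRel S.coinv).mkQ)) ∧
     (∃ σ23 : TensorOver3 (k := k) S.coinv →ₗ[k] TensorOver3 (k := k) S.coinv,
        σ23 ∘ₗ (balRel3 S.coinv).mkQ =
          TensorProduct.lift (pair23 S.coinv) ∘ₗ
            LinearMap.lTensor A (σ ∘ₗ (balRel S.coinv).mkQ) ∘ₗ
            (TensorProduct.assoc k A A A).toLinearMap) ∧
     (∃ mA : TensorOver (k := k) S.coinv →ₗ[k] A,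
        mA ∘ₗ (balRel S.coinv).mkQ = LinearMap.mul' k A) ∧
     (∃ m12 : TensorOver3 (k := k) S.coinv →ₗ[k] TensorOver (k := k) S.coinv,
        m12 ∘ₗ (balRel3 S.coinv).mkQ =
          (balRel S.coinv).mkQ ∘ₗ LinearMap.rTensor A (LinearMap.mul' k A)) ∧
     (∃ m23 : TensorOver3 (k := k) S.coinv →ₗ[k] TensorOver (k := k) S.coinv,
        m23 ∘ₗ (balRel3 S.coinv).mkQ =
          (balRel S.coinv).mkQ ∘ₗ LinearMap.lTensor A (LinearMap.mul' k A) ∘ₗ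
            (TensorProduct.assoc k A A A).toLinearMap)) ∧
    -- ... and (ii) the braid equation, (iii) braided commutativity and
    -- (iv)+(v) the hexagon relations hold
    (∀ σ12 σ23 : TensorOver3 (k := k) S.coinv →ₗ[k] TensorOver3 (k := k) S.coinv,
      ∀ mA : TensorOver (k := k) S.coinv →ₗ[k] A,
      ∀ m12 m23 : TensorOver3 (k := k) S.coinv →ₗ[k] TensorOver (k := k) S.coinv,
      σ12 ∘ₗ (balRel3 S.coinv).mkQ =
        TensorProduct.lift (pair12 S.coinv) ∘ₗ
          LinearMap.rTensor A (σ ∘ₗ (balRel S.coinv).mkQ) →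
      σ23 ∘ₗ (balRel3 S.coinv).mkQ =
        TensorProduct.lift (pair23 S.coinv) ∘ₗ
          LinearMap.lTensor A (σ ∘ₗ (balRel S.coinv).mkQ) ∘ₗ
          (TensorProduct.assoc k A A A).toLinearMap →
      mA ∘ₗ (balRel S.coinv).mkQ = LinearMap.mul' k A →
      m12 ∘ₗ (balRel3 S.coinv).mkQ =
        (balRel S.coinv).mkQ ∘ₗ LinearMap.rTensor A (LinearMap.mul' k A) →
      m23 ∘ₗ (balRel3 S.coinv).mkQ =
        (balRel S.coinv).mkQ ∘ₗ LinearMap.lTensor A (LinearMap.mul' k A) ∘ₗ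
          (TensorProduct.assoc k A A A).toLinearMap →
      (σ12 ∘ₗ σ23 ∘ₗ σ12 = σ23 ∘ₗ σ12 ∘ₗ σ23) ∧
      (mA ∘ₗ σ = mA) ∧
      (σ ∘ₗ m12 = m23 ∘ₗ σ12 ∘ₗ σ23) ∧
      (σ ∘ₗ m23 = m12 ∘ₗ σ23 ∘ₗ σ12)) := by
  have hG : S.IsHopfGalois := hQPB.1
  have hχinj : Function.Injective (chiQ S hQPB.1.2.ge) := hG.bijective_chiQ.1
  have hθinj : Function.Injective (chiFlip S) := chiFlip_injective S hG hSinv1 hSinv2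
  have hσχ : ∀ t, chiQ S hQPB.1.2.ge (σ t) = chiFlip S t := by
    intro t
    obtain ⟨z, rfl⟩ := (balRel S.coinv).mkQ_surjective t
    rw [← chiQ_braidAux S hQPB.1.2.ge hτ, ← hσ, LinearMap.comp_apply]
  have hσl : ∀ b ∈ S.coinv, ∀ t, σ (lmulQ S.coinv b t) = lmulQ S.coinv b (σ t) := by
    intro b hb t
    apply hχinj
    rw [hσχ, chiFlip_lmulQ, chiQ_lmulQ, hσχ, S.ρ_of_mem hb]
  have hσr : ∀ b ∈ S.coinv, ∀ t, σ (rmulQ S.coinv b t) = rmulQ S.coinv b (σ t) := by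
    intro b hb t
    apply hχinj
    rw [hσχ, chiFlip_rmulQ, chiQ_rmulQ, hσχ, S.ρ_of_mem hb]
  refine ⟨⟨?_, ?_, hσl, hσr⟩, ⟨?_, ?_, ?_, ?_, ?_⟩, ?_⟩
  · refine ⟨Submodule.liftQ _ (braidInvAux S Sinv τ) fun z hz => ?_, Submodule.liftQ_mkQ _ _ _⟩
    rw [LinearMap.mem_ker]
    apply hθinj
    rw [chiFlip_braidInvAux S hQPB.1.2.ge hτ hSinv2, Submodule.mkQ_apply,
      (Submodule.Quotient.mk_eq_zero _).2 hz, map_zero, map_zero]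
  · intro σi hσi
    have hσiχ : ∀ t, chiFlip S (σi t) = chiQ S hQPB.1.2.ge t := by
      intro t
      obtain ⟨z, rfl⟩ := (balRel S.coinv).mkQ_surjective t
      rw [← chiFlip_braidInvAux S hQPB.1.2.ge hτ hSinv2, ← hσi, LinearMap.comp_apply]
    exact ⟨fun t => hθinj (by rw [hσiχ, hσχ]), fun t => hχinj (by rw [hσχ, hσiχ])⟩
  · refine ⟨Submodule.liftQ _ _ (balRel3_le_ker _ _ ?_ ?_), Submodule.liftQ_mkQ _ _ _⟩
    · intro a a' c b hb
      simp only [LinearMap.comp_apply, LinearMap.rTensor_tmul, TensorProduct.lift.tmul,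
        mk_mul_tmul S.coinv a a' hb]
    · intro a a' c b hb
      simp only [LinearMap.comp_apply, LinearMap.rTensor_tmul, TensorProduct.lift.tmul]
      rw [← rmulQ_mk, hσr b hb, pair12_rmulQ _ _ hb]
  · refine ⟨Submodule.liftQ _ _ (balRel3_le_ker _ _ ?_ ?_), Submodule.liftQ_mkQ _ _ _⟩
    · intro a a' c b hb
      simp only [LinearMap.comp_apply, LinearEquiv.coe_coe, TensorProduct.assoc_tmul,
        LinearMap.lTensor_tmul, TensorProduct.lift.tmul]
      rw [← lmulQ_mk, hσl b hb, pair23_mul _ _ hb]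
    · intro a a' c b hb
      simp only [LinearMap.comp_apply, LinearEquiv.coe_coe, TensorProduct.assoc_tmul,
        LinearMap.lTensor_tmul, TensorProduct.lift.tmul, mk_mul_tmul S.coinv a' c hb]
  · refine ⟨Submodule.liftQ _ _ (balRel_le_ker _ _ ?_), Submodule.liftQ_mkQ _ _ _⟩
    intro a a' b hb
    simp [mul_assoc]
  · refine ⟨Submodule.liftQ _ _ (balRel3_le_ker _ _ ?_ ?_), Submodule.liftQ_mkQ _ _ _⟩
    · intro a a' c b hb
      simp [mul_assoc]
    · intro a a' c b hb
      simp only [LinearMap.comp_apply, LinearMap.rTensor_tmul, LinearMap.mul'_apply]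
      rw [← mul_assoc, mk_mul_tmul _ _ _ hb]
  · refine ⟨Submodule.liftQ _ _ (balRel3_le_ker _ _ ?_ ?_), Submodule.liftQ_mkQ _ _ _⟩
    · intro a a' c b hb
      simp only [LinearMap.comp_apply, LinearEquiv.coe_coe, TensorProduct.assoc_tmul,
        LinearMap.lTensor_tmul, LinearMap.mul'_apply]
      rw [mul_assoc, mk_mul_tmul _ _ _ hb]
    · intro a a' c b hb
      simp [mul_assoc]
  · intro σ12 σ23 mA m12 m23 h12 h23 hmA hm12 hm23
    have hm12' : ∀ a b c : A, m12 ((balRel3 S.coinv).mkQ ((a ⊗ₜ b) ⊗ₜ c)) =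
        (balRel S.coinv).mkQ ((a * b) ⊗ₜ c) := fun a b c =>
      LinearMap.congr_fun hm12 ((a ⊗ₜ b) ⊗ₜ c)
    have hm23' : ∀ a b c : A, m23 ((balRel3 S.coinv).mkQ ((a ⊗ₜ b) ⊗ₜ c)) =
        (balRel S.coinv).mkQ (a ⊗ₜ (b * c)) := fun a b c =>
      LinearMap.congr_fun hm23 ((a ⊗ₜ b) ⊗ₜ c)
    have hB : ∀ b ∈ S.coinv, S.incl b = S.ρ b := S.incl_eq_ρ
    have hB' : ∀ b ∈ S.coinv, S.ρ b = S.incl b := fun b hb => (hB b hb).symm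
    refine ⟨?_, ?_, ?_, ?_⟩
    · set α := S.leg12.comp S.incl with hα
      set β := S.leg12.comp S.ρ with hβ
      set γ := S.leg23.comp S.ρ with hγ
      have hαβ : ∀ b ∈ S.coinv, α b = β b := fun b hb => by simp [hα, hβ, S.ρ_of_mem hb]
      have hβγ : ∀ b ∈ S.coinv, β b = γ b := fun b hb => by
        simp [hβ, hγ, S.ρ_of_mem hb, S.leg23_incl]
      have hαγ : ∀ b ∈ S.coinv, α b = γ b := fun b hb => (hαβ b hb).trans (hβγ b hb)
      have hβα : ∀ b ∈ S.coinv, β b = α b := fun b hb => (hαβ b hb).symm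
      have hγα : ∀ b ∈ S.coinv, γ b = α b := fun b hb => (hαγ b hb).symm
      have hγβ : ∀ b ∈ S.coinv, γ b = β b := fun b hb => (hβγ b hb).symm
      have e1 : chi3 S ∘ₗ σ12 = tripleMul hβα hαγ :=
        tripleMul_comp_braid12 S hQPB.1.2.ge hσχ S.leg12 (fun _ => rfl) (fun _ => rfl)
          hαβ hβγ hαγ h12
      have e2 : tripleMul hβα hαγ ∘ₗ σ23 = tripleMul hβγ hγα :=
        tripleMul_comp_braid23 S hQPB.1.2.ge hσχ S.leg13 S.leg13_incl S.leg13_ρ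
          hβα hαγ hβγ h23
      have e3 : tripleMul hβγ hγα ∘ₗ σ12 = tripleMul hγβ hβα :=
        tripleMul_comp_braid12 S hQPB.1.2.ge hσχ S.leg23 S.leg23_incl (fun _ => rfl)
          hβγ hγα hβα h12
      have e4 : chi3 S ∘ₗ σ23 = tripleMul hαγ hγβ :=
        tripleMul_comp_braid23 S hQPB.1.2.ge hσχ S.leg23 S.leg23_incl (fun _ => rfl)
          hαβ hβγ hαγ h23
      have e5 : tripleMul hαγ hγβ ∘ₗ σ12 = tripleMul hγα hαβ :=
        tripleMul_comp_braid12 S hQPB.1.2.ge hσχ S.leg13 S.leg13_incl S.leg13_ρ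
          hαγ hγβ hαβ h12
      have e6 : tripleMul hγα hαβ ∘ₗ σ23 = tripleMul hγβ hβα :=
        tripleMul_comp_braid23 S hQPB.1.2.ge hσχ S.leg12 (fun _ => rfl) (fun _ => rfl)
          hγα hαβ hγβ h23
      apply LinearMap.cancel_left (chi3_injective S hG) |>.1
      rw [← LinearMap.comp_assoc, ← LinearMap.comp_assoc, e1, e2, e3,
        ← LinearMap.comp_assoc, ← LinearMap.comp_assoc, e4, e5, e6]
    · have hmχ : ∀ t, mA t = S.counitRight (chiQ S hQPB.1.2.ge t) := by
        intro t
        induction t using tensorOver_induction with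
        | zero => simp
        | mk a a' =>
          rw [chiQ_mk, map_mul, S.counitRight_incl, S.counitRight_ρ]
          exact LinearMap.congr_fun hmA (a ⊗ₜ a')
        | add x y hx hy => simp only [map_add, hx, hy]
      refine LinearMap.ext fun t => ?_
      rw [LinearMap.comp_apply, hmχ, hσχ]
      induction t using tensorOver_induction with
      | zero => simp
      | mk a a' =>
        simp only [hmχ, chiFlip_mk, chiQ_mk, map_mul, S.counitRight_incl, S.counitRight_ρ]
      | add x y hx hy => simp only [map_add, hx, hy]
    · have e1 : chiQ S hQPB.1.2.ge ∘ₗ m23 = tripleMul hB (fun _ _ => rfl) :=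
        tensorOver3_hom_ext fun a b c => by
          rw [LinearMap.comp_apply, hm23', chiQ_mk, tripleMul_mk, map_mul, mul_assoc]
      have e2 : tripleMul hB (fun _ _ => rfl) ∘ₗ σ12 = tripleMul hB' hB :=
        tripleMul_comp_braid12 S hQPB.1.2.ge hσχ (AlgHom.id k _) (fun _ => rfl) (fun _ => rfl)
          hB (fun _ _ => rfl) hB h12
      have e3 : tripleMul hB' hB ∘ₗ σ23 = tripleMul (fun _ _ => rfl) hB' :=
        tripleMul_comp_braid23 S hQPB.1.2.ge hσχ (AlgHom.id k _) (fun _ => rfl) (fun _ => rfl)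
          hB' hB (fun _ _ => rfl) h23
      have e4 : chiQ S hQPB.1.2.ge ∘ₗ σ ∘ₗ m12 = tripleMul (fun _ _ => rfl) hB' :=
        tensorOver3_hom_ext fun a b c => by
          rw [LinearMap.comp_apply, LinearMap.comp_apply, hσχ, hm12', chiFlip_mk, tripleMul_mk,
            map_mul]
      apply LinearMap.cancel_left hχinj |>.1
      rw [e4, ← LinearMap.comp_assoc, ← LinearMap.comp_assoc, e1, e2, e3]
    · have e1 : chiQ S hQPB.1.2.ge ∘ₗ m12 = tripleMul (fun _ _ => rfl) hB :=
        tensorOver3_hom_ext fun a b c => by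
          rw [LinearMap.comp_apply, hm12', chiQ_mk, tripleMul_mk, map_mul]
      have e2 : tripleMul (fun _ _ => rfl) hB ∘ₗ σ23 = tripleMul hB hB' :=
        tripleMul_comp_braid23 S hQPB.1.2.ge hσχ (AlgHom.id k _) (fun _ => rfl) (fun _ => rfl)
          (fun _ _ => rfl) hB hB h23
      have e3 : tripleMul hB hB' ∘ₗ σ12 = tripleMul hB' (fun _ _ => rfl) :=
        tripleMul_comp_braid12 S hQPB.1.2.ge hσχ (AlgHom.id k _) (fun _ => rfl) (fun _ => rfl)
          hB hB' (fun _ _ => rfl) h12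
      have e4 : chiQ S hQPB.1.2.ge ∘ₗ σ ∘ₗ m23 = tripleMul hB' (fun _ _ => rfl) :=
        tensorOver3_hom_ext fun a b c => by
          rw [LinearMap.comp_apply, LinearMap.comp_apply, hσχ, hm23', chiFlip_mk, tripleMul_mk,
            map_mul, mul_assoc]
      apply LinearMap.cancel_left hχinj |>.1
      rw [e4, ← LinearMap.comp_assoc, ← LinearMap.comp_assoc, e1, e2, e3]

end NCG
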